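/- arXiv:2507.09962 — 4 statements merged into one kernel-verified Lean document; each statement's English description precedes it below -/
import Mathlib

section
/- Let d ≥ 2. There is a constant C_d such that for every δ ∈ (0,1/2) and every ξ ∈ ℝ^d, the Fourier transform of the indicator function of the annulus C^δ(0,1) satisfies |χ̂_{C^δ(0,1)}(ξ)| ≤ C_d δ (1+|ξ|)^{−(d−1)/2}. -/
open MeasureTheory Metric Filter
open scoped ENNReal FourierTransform Pointwise Topology

noncomputable section

/-- `C^δ(0,1)`: the δ-neighbourhood of the unit sphere in `ℝ^d`. -/
def annulus (d : ℕ) (δ : ℝ) : Set (EuclideanSpace ℝ (Fin d)) :=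
  {y | 1 - δ < ‖y‖ ∧ ‖y‖ < 1 + δ}

/-- The oscillating factor `e^{i x sin θ}`. -/
def sinePhase (x θ : ℝ) : ℂ := Complex.exp (x * Real.sin θ * Complex.I)

/-- The oscillatory integral `∫_{-π/2}^{π/2} e^{i x sin θ} g(θ) dθ`. -/
def sineIntegral (g : ℝ → ℝ) (x : ℝ) : ℂ :=
  ∫ θ in -(Real.pi / 2)..Real.pi / 2, sinePhase x θ * g θ

lemma norm_sinePhase (x θ : ℝ) : ‖sinePhase x θ‖ = 1 := by
  rw [sinePhase, ← Complex.ofReal_mul, Complex.norm_exp_ofReal_mul_I]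

@[fun_prop]
lemma continuous_sinePhase (x : ℝ) : Continuous (sinePhase x) := by
  unfold sinePhase; fun_prop

lemma hasDerivAt_sinePhase (x θ : ℝ) :
    HasDerivAt (sinePhase x) (x * Complex.I * (sinePhase x θ * Real.cos θ)) θ := by
  have h := (((Real.hasDerivAt_sin θ).ofReal_comp.const_mul (x : ℂ)).mul_const Complex.I).cexp
  refine h.congr_deriv ?_
  rw [sinePhase]; ring

lemma integral_sinePhase_cos_mul {a b : ℝ} (x : ℝ) {g g' : ℝ → ℝ}
    (hg : ∀ θ ∈ Set.uIcc a b, HasDerivAt g (g' θ) θ) (hg' : ContinuousOn g' (Set.uIcc a b)) :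
    x * Complex.I * ∫ θ in a..b, sinePhase x θ * (Real.cos θ * g θ : ℝ) =
      sinePhase x b * g b - sinePhase x a * g a - ∫ θ in a..b, sinePhase x θ * g' θ := by
  have h := intervalIntegral.integral_deriv_mul_eq_sub (a := a) (b := b) (u := sinePhase x)
    (v := fun θ => (g θ : ℂ)) (u' := fun θ => x * Complex.I * (sinePhase x θ * Real.cos θ))
    (v' := fun θ => (g' θ : ℂ)) (fun θ _ => hasDerivAt_sinePhase x θ)
    (fun θ hθ => (hg θ hθ).ofReal_comp) ?_ ?_
  · have hgc : ContinuousOn g (Set.uIcc a b) := fun θ hθ => (hg θ hθ).continuousAt.continuousWithinAt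
    rw [← h, intervalIntegral.integral_add, add_sub_cancel_right,
      ← intervalIntegral.integral_const_mul]
    · congr 1; ext θ; push_cast; ring
    · exact ContinuousOn.intervalIntegrable (by fun_prop)
    · exact ContinuousOn.intervalIntegrable (by fun_prop)
  · exact Continuous.intervalIntegrable (by fun_prop) _ _
  · exact ContinuousOn.intervalIntegrable (by fun_prop)

lemma norm_integral_sinePhase_mul_le {a b M : ℝ} (x : ℝ) {g : ℝ → ℝ}
    (hg : ∀ θ ∈ Set.uIoc a b, |g θ| ≤ M) :
    ‖∫ θ in a..b, sinePhase x θ * g θ‖ ≤ M * |b - a| := by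
  refine intervalIntegral.norm_integral_le_of_norm_le_const fun θ hθ => ?_
  rw [norm_mul, norm_sinePhase, one_mul, Complex.norm_real]
  exact hg θ hθ

lemma norm_integral_sinePhase_mul_le_of_cos_pos {c M : ℝ} (hc : 0 ≤ c) (hc' : c < Real.pi / 2)
    {g g' : ℝ → ℝ}
    (hg : ∀ θ, HasDerivAt g (g' θ) θ) (hg' : Continuous g') (hM : ∀ θ, |g θ| ≤ M)
    (hM' : ∀ θ, |g' θ| ≤ M) (x : ℝ) :
    |x| * ‖∫ θ in -c..c, sinePhase x θ * g θ‖ * Real.cos c ≤ 6 * M := by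
  have hM0 : 0 ≤ M := (abs_nonneg _).trans (hM 0)
  have hcos : ∀ θ ∈ Set.uIcc (-c) c, 0 < Real.cos θ := by
    intro θ hθ
    rw [Set.uIcc_of_le (by linarith)] at hθ
    exact Real.cos_pos_of_mem_Ioo ⟨by linarith [hθ.1], by linarith [hθ.2]⟩
  have hcc : 0 < Real.cos c := hcos c (by simp)
  set h : ℝ → ℝ := fun θ => g θ / Real.cos θ
  set h' : ℝ → ℝ := fun θ => (g' θ * Real.cos θ - g θ * (-Real.sin θ)) / Real.cos θ ^ 2
  have hgc : Continuous g := continuous_iff_continuousAt.2 fun θ => (hg θ).continuousAt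
  have hcont : ContinuousOn h' (Set.uIcc (-c) c) := by
    refine ContinuousOn.div (by fun_prop) (by fun_prop) fun θ hθ => (pow_pos (hcos θ hθ) 2).ne'
  have key := integral_sinePhase_cos_mul (a := -c) (b := c) x (g := h) (g' := h')
    (fun θ hθ => (hg θ).div (Real.hasDerivAt_cos θ) (hcos θ hθ).ne') hcont
  have e1 : ∫ θ in -c..c, sinePhase x θ * (Real.cos θ * h θ : ℝ) =
      ∫ θ in -c..c, sinePhase x θ * g θ := by
    refine intervalIntegral.integral_congr fun θ hθ => ?_
    simp only [h]
    rw [mul_div_cancel₀ _ (hcos θ hθ).ne']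
  have htan : ∫ θ in -c..c, 2 * M * (1 / Real.cos θ ^ 2) = 4 * M * Real.tan c := by
    rw [intervalIntegral.integral_const_mul, intervalIntegral.integral_eq_sub_of_hasDerivAt
      (fun θ hθ => Real.hasDerivAt_tan (hcos θ hθ).ne'), Real.tan_neg]
    · ring
    · exact ContinuousOn.intervalIntegrable (ContinuousOn.div (by fun_prop) (by fun_prop)
        fun θ hθ => (pow_pos (hcos θ hθ) 2).ne')
  have e2 : ‖∫ θ in -c..c, sinePhase x θ * h' θ‖ ≤ 4 * M * Real.tan c := by
    rw [← htan]
    refine intervalIntegral.norm_integral_le_of_norm_le (by linarith) ?_ ?_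
    · refine Eventually.of_forall fun θ hθ => ?_
      have hθ' := hcos θ (by rw [Set.uIcc_of_le (by linarith)]; exact ⟨hθ.1.le, hθ.2⟩)
      rw [norm_mul, norm_sinePhase, one_mul, Complex.norm_real, Real.norm_eq_abs, abs_div,
        abs_of_pos (pow_pos hθ' 2), mul_one_div]
      refine div_le_div_of_nonneg_right ?_ (by positivity)
      have h1 : |g' θ * Real.cos θ| ≤ M * 1 := by
        rw [abs_mul]
        exact mul_le_mul (hM' θ) (Real.abs_cos_le_one θ) (abs_nonneg _) hM0
      have h2 : |g θ * (-Real.sin θ)| ≤ M * 1 := by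
        rw [abs_mul, abs_neg]
        exact mul_le_mul (hM θ) (Real.abs_sin_le_one θ) (abs_nonneg _) hM0
      linarith [abs_sub (g' θ * Real.cos θ) (g θ * (-Real.sin θ))]
    · exact ContinuousOn.intervalIntegrable (ContinuousOn.mul (by fun_prop)
        (ContinuousOn.div (by fun_prop) (by fun_prop) fun θ hθ => (pow_pos (hcos θ hθ) 2).ne'))
  have e3 : Real.tan c * Real.cos c ≤ 1 := by
    rw [Real.tan_mul_cos hcc.ne']; exact Real.sin_le_one c
  have e4 : ∀ θ, Real.cos θ = Real.cos c → ‖sinePhase x θ * h θ‖ * Real.cos c ≤ M := by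
    intro θ hθ
    rw [norm_mul, norm_sinePhase, one_mul, Complex.norm_real, Real.norm_eq_abs, abs_div, hθ,
      abs_of_pos hcc, div_mul_cancel₀ _ hcc.ne']
    exact hM θ
  have e5 : |x| * ‖∫ θ in -c..c, sinePhase x θ * g θ‖ ≤
      ‖sinePhase x c * h c‖ + ‖sinePhase x (-c) * h (-c)‖ + 4 * M * Real.tan c := by
    rw [e1] at key
    have := congrArg norm key
    rw [norm_mul, norm_mul, Complex.norm_I, mul_one, Complex.norm_real, Real.norm_eq_abs] at this
    rw [this]
    refine (norm_sub_le _ _).trans (add_le_add (norm_sub_le _ _) e2)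
  calc _ ≤ (‖sinePhase x c * h c‖ + ‖sinePhase x (-c) * h (-c)‖ + 4 * M * Real.tan c)
        * Real.cos c := mul_le_mul_of_nonneg_right e5 hcc.le
    _ ≤ 6 * M := by
      have := e4 c rfl
      have := e4 (-c) (Real.cos_neg c)
      nlinarith

/-- Van der Corput type bound: the phase `sin θ` has nondegenerate critical points at `±π/2`. -/
lemma norm_sineIntegral_mul_sqrt_le {M : ℝ} {g g' : ℝ → ℝ}
    (hg : ∀ θ, HasDerivAt g (g' θ) θ) (hg' : Continuous g') (hM : ∀ θ, |g θ| ≤ M)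
    (hM' : ∀ θ, |g' θ| ≤ M) {x : ℝ} (hx : 1 ≤ |x|) :
    ‖sineIntegral g x‖ * √|x| ≤ 14 * M := by
  have hM0 : 0 ≤ M := (abs_nonneg _).trans (hM 0)
  set s := √|x| with hs
  have hs1 : 1 ≤ s := Real.one_le_sqrt.2 hx
  have hs2 : s * s = |x| := Real.mul_self_sqrt (abs_nonneg x)
  have hs0 : 0 < s := by linarith
  set ε := s⁻¹ with hε
  have hε0 : 0 < ε := inv_pos.2 hs0
  have hε1 : ε ≤ 1 := inv_le_one_of_one_le₀ hs1
  have hsε : s * ε = 1 := mul_inv_cancel₀ hs0.ne'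
  have hpi := Real.pi_gt_three
  have hpi4 := Real.pi_le_four
  set c := Real.pi / 2 - ε with hc
  have hcos : ε / 2 ≤ Real.cos c := by
    rw [hc, Real.cos_pi_div_two_sub]
    refine le_trans ?_ (Real.mul_le_sin hε0.le (by linarith))
    rw [div_mul_eq_mul_div, div_le_div_iff₀ (by norm_num) Real.pi_pos]
    nlinarith
  have hmid := norm_integral_sinePhase_mul_le_of_cos_pos (c := c) (by linarith) (by linarith)
    hg hg' hM hM' x
  have hgc : Continuous g := continuous_iff_continuousAt.2 fun θ => (hg θ).continuousAt
  have hint : ∀ a b, IntervalIntegrable (fun θ => sinePhase x θ * (g θ : ℂ)) volume a b :=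
    fun a b => Continuous.intervalIntegrable (by fun_prop) _ _
  have hl := norm_integral_sinePhase_mul_le (a := -(Real.pi / 2)) (b := -c) x fun θ _ => hM θ
  have hr := norm_integral_sinePhase_mul_le (a := c) (b := Real.pi / 2) x fun θ _ => hM θ
  have hl' : |(-c) - -(Real.pi / 2)| = ε := by rw [hc, abs_of_nonneg] <;> linarith
  have hr' : |Real.pi / 2 - c| = ε := by rw [hc, abs_of_nonneg] <;> linarith
  rw [hl'] at hl
  rw [hr'] at hr
  have hsum : ‖sineIntegral g x‖ ≤ M * ε + ‖∫ θ in -c..c, sinePhase x θ * g θ‖ + M * ε := by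
    rw [sineIntegral, ← intervalIntegral.integral_add_adjacent_intervals (hint _ c) (hint c _),
      ← intervalIntegral.integral_add_adjacent_intervals (hint _ (-c)) (hint (-c) c)]
    exact (norm_add_le _ _).trans (add_le_add ((norm_add_le _ _).trans (add_le_add hl le_rfl)) hr)
  set N := ‖∫ θ in -c..c, sinePhase x θ * g θ‖
  have hN : N * s ≤ 12 * M := by
    have h0 : 0 ≤ |x| * N := by positivity
    have h1 : |x| * N * (ε / 2) ≤ 6 * M := (mul_le_mul_of_nonneg_left hcos h0).trans hmid
    have h2 : |x| * N * (ε / 2) = N * s * (s * ε) / 2 := by rw [← hs2]; ring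
    rw [h2, hsε] at h1
    linarith
  calc _ ≤ (M * ε + N + M * ε) * s := mul_le_mul_of_nonneg_right hsum hs0.le
    _ = 2 * M * (s * ε) + N * s := by ring
    _ ≤ 14 * M := by rw [hsε]; linarith

/-- `∫_{-π/2}^{π/2} e^{i x sin θ} cos^k θ dθ`. -/
def cosIntegral (k : ℕ) : ℝ → ℂ := sineIntegral fun θ => Real.cos θ ^ k

/-- `∫_{-π/2}^{π/2} e^{i x sin θ} sin θ cos^k θ dθ`. -/
def sinCosIntegral (k : ℕ) : ℝ → ℂ := sineIntegral fun θ => Real.sin θ * Real.cos θ ^ k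

lemma mul_cosIntegral_add_two (k : ℕ) (x : ℝ) :
    x * Complex.I * cosIntegral (k + 2) x = (k + 1) * sinCosIntegral k x := by
  have h := integral_sinePhase_cos_mul (a := -(Real.pi / 2)) (b := Real.pi / 2) x
    (g := fun θ => Real.cos θ ^ (k + 1)) (g' := fun θ => (k + 1) * Real.cos θ ^ k * -Real.sin θ)
    (fun θ _ => by simpa using (Real.hasDerivAt_cos θ).fun_pow (k + 1)) (by fun_prop)
  simp only [Real.cos_neg, Real.cos_pi_div_two, ne_eq, Nat.add_eq_zero_iff, one_ne_zero,
    and_false, not_false_eq_true, zero_pow, Complex.ofReal_zero, mul_zero, sub_zero, zero_sub,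
    ← intervalIntegral.integral_neg] at h
  rw [sinCosIntegral, sineIntegral, ← intervalIntegral.integral_const_mul, cosIntegral,
    sineIntegral]
  refine Eq.trans (congrArg _ (intervalIntegral.integral_congr fun θ _ => ?_))
    (h.trans (intervalIntegral.integral_congr fun θ _ => ?_))
  · congr 2; ring
  · push_cast; ring

lemma mul_sinCosIntegral_add_two (k : ℕ) (x : ℝ) :
    x * Complex.I * sinCosIntegral (k + 2) x =
      (k + 1) * cosIntegral k x - (k + 2) * cosIntegral (k + 2) x := by
  have h := integral_sinePhase_cos_mul (a := -(Real.pi / 2)) (b := Real.pi / 2) x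
    (g := fun θ => Real.sin θ * Real.cos θ ^ (k + 1))
    (g' := fun θ => Real.cos θ * Real.cos θ ^ (k + 1) +
      Real.sin θ * ((k + 1) * Real.cos θ ^ k * -Real.sin θ))
    (fun θ _ => by
      simpa using (Real.hasDerivAt_sin θ).fun_mul ((Real.hasDerivAt_cos θ).fun_pow (k + 1))) (by fun_prop)
  simp only [Real.cos_neg, Real.cos_pi_div_two, ne_eq, Nat.add_eq_zero_iff, one_ne_zero,
    and_false, not_false_eq_true, zero_pow, Complex.ofReal_zero, mul_zero, sub_zero, zero_sub,
    ← intervalIntegral.integral_neg] at h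
  simp only [sinCosIntegral, cosIntegral, sineIntegral, ← intervalIntegral.integral_const_mul]
  rw [← intervalIntegral.integral_sub (Continuous.intervalIntegrable (by fun_prop) _ _)
    (Continuous.intervalIntegrable (by fun_prop) _ _)]
  rw [intervalIntegral.integral_const_mul]
  refine Eq.trans (congrArg _ (intervalIntegral.integral_congr fun θ _ => ?_))
    (h.trans (intervalIntegral.integral_congr fun θ _ => ?_))
  · congr 2; ring
  · have := Complex.sin_sq_add_cos_sq θ
    push_cast
    linear_combination ((k + 1) * sinePhase x θ * Complex.cos θ ^ k) * this

lemma sq_mul_cosIntegral_add_four (k : ℕ) (x : ℝ) :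
    (x : ℂ) ^ 2 * cosIntegral (k + 4) x =
      (k + 3) * ((k + 2) * cosIntegral (k + 2) x - (k + 1) * cosIntegral k x) := by
  have h1 := mul_cosIntegral_add_two (k + 2) x
  have h2 := mul_sinCosIntegral_add_two k x
  push_cast at h1
  linear_combination (-(x : ℂ) * Complex.I) * h1 - (k + 3) * h2 +
    (x : ℂ) ^ 2 * cosIntegral (k + 4) x * Complex.I_sq

lemma norm_cosIntegral_le (k : ℕ) (x : ℝ) : ‖cosIntegral k x‖ ≤ Real.pi := by
  refine (norm_integral_sinePhase_mul_le (M := 1) x fun θ _ => ?_).trans_eq ?_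
  · rw [abs_pow]; exact pow_le_one₀ (abs_nonneg _) (Real.abs_cos_le_one θ)
  · rw [abs_of_nonneg] <;> linarith [Real.pi_pos]

lemma abs_mul_norm_sineIntegral_cos_mul_le {M : ℝ} {g g' : ℝ → ℝ}
    (hg : ∀ θ, HasDerivAt g (g' θ) θ) (hg' : Continuous g') (hM : ∀ θ, |g θ| ≤ M)
    (hM' : ∀ θ, |g' θ| ≤ M) (x : ℝ) :
    |x| * ‖sineIntegral (fun θ => Real.cos θ * g θ) x‖ ≤ 6 * M := by
  have hM0 : 0 ≤ M := (abs_nonneg _).trans (hM 0)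
  have h := integral_sinePhase_cos_mul (a := -(Real.pi / 2)) (b := Real.pi / 2) x
    (fun θ _ => hg θ) hg'.continuousOn
  have := congrArg norm h
  rw [norm_mul, norm_mul, Complex.norm_I, mul_one, Complex.norm_real, Real.norm_eq_abs] at this
  have e : ∀ θ, ‖sinePhase x θ * g θ‖ ≤ M := fun θ => by
    rw [norm_mul, norm_sinePhase, one_mul, Complex.norm_real]; exact hM θ
  have e2 := norm_integral_sinePhase_mul_le (a := -(Real.pi / 2)) (b := Real.pi / 2) x
    fun θ _ => hM' θ
  rw [abs_of_nonneg (by linarith [Real.pi_pos])] at e2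
  rw [sineIntegral, this]
  refine ((norm_sub_le _ _).trans (add_le_add ((norm_sub_le _ _).trans
    (add_le_add (e _) (e _))) e2)).trans ?_
  nlinarith [Real.pi_le_four]

lemma exists_norm_cosIntegral_mul_sqrt_abs_pow_le (k : ℕ) :
    ∃ C : ℝ, ∀ x : ℝ, 1 ≤ |x| → ‖cosIntegral k x‖ * √|x| ^ (k + 1) ≤ C := by
  have hsq : ∀ x : ℝ, √|x| ^ 2 = |x| := fun x => Real.sq_sqrt (abs_nonneg x)
  induction k using Nat.strong_induction_on with
  | _ k ih =>
  match k with
  | 0 =>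
    refine ⟨14 * 1, fun x hx => ?_⟩
    have := norm_sineIntegral_mul_sqrt_le (M := 1) (g := fun _ => 1) (g' := fun _ => 0)
      (fun θ => hasDerivAt_const θ 1) (by fun_prop) (by simp) (by simp) hx
    simpa [cosIntegral] using this
  | 1 =>
    refine ⟨6 * 1, fun x hx => ?_⟩
    have := abs_mul_norm_sineIntegral_cos_mul_le (M := 1) (g := fun _ => 1) (g' := fun _ => 0)
      (fun θ => hasDerivAt_const θ 1) (by fun_prop) (by simp) (by simp) x
    rw [hsq, mul_comm]
    simpa [cosIntegral] using this
  | 2 =>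
    refine ⟨14 * 1, fun x hx => ?_⟩
    have := norm_sineIntegral_mul_sqrt_le (M := 1) (g := Real.sin) (g' := Real.cos)
      Real.hasDerivAt_sin (by fun_prop) Real.abs_sin_le_one Real.abs_cos_le_one hx
    have h := congrArg norm (mul_cosIntegral_add_two 0 x)
    simp only [norm_mul, Complex.norm_I, mul_one, Complex.norm_real, Real.norm_eq_abs,
      sinCosIntegral, zero_add, Nat.cast_zero, pow_zero, one_mul] at h
    rw [← h] at this
    rw [pow_succ, hsq]
    linarith
  | 3 =>
    refine ⟨2 * (6 * 1), fun x hx => ?_⟩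
    have := abs_mul_norm_sineIntegral_cos_mul_le (M := 1) (g := Real.sin) (g' := Real.cos)
      Real.hasDerivAt_sin (by fun_prop) Real.abs_sin_le_one Real.abs_cos_le_one x
    have h := congrArg norm (mul_cosIntegral_add_two 1 x)
    have h2 : ‖(1 : ℂ) + 1‖ = 2 := by norm_num
    simp only [norm_mul, Complex.norm_I, mul_one, Complex.norm_real, Real.norm_eq_abs,
      sinCosIntegral, Nat.cast_one, h2, pow_one, Nat.reduceAdd] at h
    simp only [mul_comm (Real.cos _)] at this
    have e : √|x| ^ (3 + 1) = |x| * |x| := by linear_combination (√|x| ^ 2 + |x|) * hsq x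
    calc _ = |x| * (|x| * ‖cosIntegral 3 x‖) := by rw [e]; ring
      _ ≤ _ := by rw [h]; linarith
  | m + 4 =>
    obtain ⟨C₁, h₁⟩ := ih (m + 2) (by omega)
    obtain ⟨C₂, h₂⟩ := ih m (by omega)
    refine ⟨(m + 3) * ((m + 2) * C₁ + (m + 1) * C₂), fun x hx => ?_⟩
    have h := congrArg norm (sq_mul_cosIntegral_add_four m x)
    rw [norm_mul, norm_pow, Complex.norm_real, Real.norm_eq_abs, norm_mul] at h
    have n3 : ‖(m : ℂ) + 3‖ = m + 3 := by
      exact_mod_cast Complex.norm_natCast (m + 3)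
    have n2 : ‖(m : ℂ) + 2‖ = m + 2 := by
      exact_mod_cast Complex.norm_natCast (m + 2)
    have n1 : ‖(m : ℂ) + 1‖ = m + 1 := by
      exact_mod_cast Complex.norm_natCast (m + 1)
    have hle := norm_sub_le (((m : ℂ) + 2) * cosIntegral (m + 2) x) ((m + 1) * cosIntegral m x)
    rw [norm_mul, norm_mul, n2, n1] at hle
    set s := √|x|
    have hs1 : 1 ≤ s := Real.one_le_sqrt.2 hx
    have e : s ^ (m + 4 + 1) = |x| ^ 2 * s ^ (m + 1) := by rw [← hsq]; ring
    calc ‖cosIntegral (m + 4) x‖ * s ^ (m + 4 + 1)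
        = |x| ^ 2 * ‖cosIntegral (m + 4) x‖ * s ^ (m + 1) := by rw [e]; ring
      _ ≤ (m + 3) * ((m + 2) * ‖cosIntegral (m + 2) x‖ + (m + 1) * ‖cosIntegral m x‖)
          * s ^ (m + 1) := by rw [h, n3]; gcongr
      _ = (m + 3) * ((m + 2) * (‖cosIntegral (m + 2) x‖ * s ^ (m + 1))
          + (m + 1) * (‖cosIntegral m x‖ * s ^ (m + 1))) := by ring
      _ ≤ (m + 3) * ((m + 2) * (‖cosIntegral (m + 2) x‖ * s ^ (m + 2 + 1))
          + (m + 1) * (‖cosIntegral m x‖ * s ^ (m + 1))) := by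
        gcongr
        exact Nat.le_add_right m 2
      _ ≤ _ := by
        gcongr
        · exact h₁ x hx
        · exact h₂ x hx

lemma exists_norm_cosIntegral_mul_sqrt_pow_le (k : ℕ) :
    ∃ C : ℝ, 0 ≤ C ∧ ∀ x : ℝ, ‖cosIntegral k x‖ * √(1 + |x|) ^ (k + 1) ≤ C := by
  obtain ⟨C, hC⟩ := exists_norm_cosIntegral_mul_sqrt_abs_pow_le k
  refine ⟨√2 ^ (k + 1) * max C Real.pi, by positivity, fun x => ?_⟩
  rcases le_total 1 |x| with hx | hx
  · have h : √(1 + |x|) ≤ √2 * √|x| := by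
      rw [← Real.sqrt_mul (by norm_num)]
      exact Real.sqrt_le_sqrt (by linarith)
    calc _ ≤ ‖cosIntegral k x‖ * (√2 * √|x|) ^ (k + 1) := by gcongr
      _ = √2 ^ (k + 1) * (‖cosIntegral k x‖ * √|x| ^ (k + 1)) := by rw [mul_pow]; ring
      _ ≤ _ := by gcongr; exact (hC x hx).trans (le_max_left _ _)
  · have h : √(1 + |x|) ≤ √2 := Real.sqrt_le_sqrt (by linarith)
    calc _ ≤ max C Real.pi * √2 ^ (k + 1) := by
          gcongr; exact (norm_cosIntegral_le k x).trans (le_max_right _ _)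
      _ = _ := mul_comm _ _

lemma hasDerivAt_cosIntegral (k : ℕ) (x : ℝ) :
    HasDerivAt (cosIntegral k) (-(x / (k + 1)) * cosIntegral (k + 2) x) x := by
  have h := (intervalIntegral.hasDerivAt_integral_of_dominated_loc_of_deriv_le
    (μ := volume) (a := -(Real.pi / 2)) (b := Real.pi / 2) (x₀ := x) (s := Set.univ)
    (F := fun x θ => sinePhase x θ * (Real.cos θ ^ k : ℝ)) (bound := fun _ => 1)
    (F' := fun x θ => Complex.I * (sinePhase x θ * (Real.sin θ * Real.cos θ ^ k : ℝ)))
    univ_mem (Eventually.of_forall fun x => Continuous.aestronglyMeasurable (by fun_prop))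
    (Continuous.intervalIntegrable (by fun_prop) _ _)
    (Continuous.aestronglyMeasurable (by fun_prop))
    (Eventually.of_forall fun θ _ x _ => ?_) (by simp)
    (Eventually.of_forall fun θ _ x _ => ?_)).2
  · refine h.congr_deriv ?_
    rw [intervalIntegral.integral_const_mul]
    have e := mul_cosIntegral_add_two k x
    have hk : (k + 1 : ℂ) ≠ 0 := Nat.cast_add_one_ne_zero k
    change Complex.I * sinCosIntegral k x = _
    field_simp
    linear_combination (-Complex.I) * e + x * cosIntegral (k + 2) x * Complex.I_sq
  · rw [norm_mul, norm_mul, norm_sinePhase, Complex.norm_I, Complex.norm_real, one_mul, one_mul,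
      Real.norm_eq_abs, abs_mul, abs_pow]
    exact mul_le_one₀ (Real.abs_sin_le_one θ) (by positivity)
      (pow_le_one₀ (abs_nonneg _) (Real.abs_cos_le_one θ))
  · have h1 := ((((hasDerivAt_id x).ofReal_comp.mul_const (Real.sin θ : ℂ)).mul_const
      Complex.I).cexp).mul_const ((Real.cos θ ^ k : ℝ) : ℂ)
    refine h1.congr_deriv ?_
    simp only [sinePhase, id]; push_cast; ring

lemma integrable_indicator_ball {V : Type*} [NormedAddCommGroup V] [InnerProductSpace ℝ V]
    [FiniteDimensional ℝ V] [MeasurableSpace V] [BorelSpace V] (R : ℝ) :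
    Integrable ((ball (0 : V) R).indicator fun _ => (1 : ℂ)) :=
  (integrable_indicator_iff measurableSet_ball).2
    (integrableOn_const measure_ball_lt_top.ne)

lemma fourier_indicator_ball_eq_of_norm_eq {V : Type*} [NormedAddCommGroup V]
    [InnerProductSpace ℝ V] [FiniteDimensional ℝ V] [MeasurableSpace V] [BorelSpace V] (R : ℝ)
    {v w : V} (h : ‖v‖ = ‖w‖) :
    𝓕 ((ball (0 : V) R).indicator fun _ => (1 : ℂ)) v =
      𝓕 ((ball (0 : V) R).indicator fun _ => (1 : ℂ)) w := by
  set A := (Submodule.span ℝ {v - w})ᗮ.reflection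
  have hA : A v = w := Submodule.reflection_sub h
  rw [← hA, ← Real.fourier_comp_linearIsometry]
  refine congrFun (congrArg _ (funext fun x => ?_)) v
  simp [Set.indicator]

lemma volume_real_ball_sqrt (n : ℕ) (r : ℝ) :
    volume.real (ball (0 : EuclideanSpace ℝ (Fin (n + 1))) √r) =
      √r ^ (n + 1) * volume.real (ball (0 : EuclideanSpace ℝ (Fin (n + 1))) 1) := by
  rw [measureReal_def, Measure.addHaar_ball _ _ (Real.sqrt_nonneg r), ENNReal.toReal_mul,
    ENNReal.toReal_ofReal (by positivity), finrank_euclideanSpace_fin, measureReal_def]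

/-- Slicing a ball by hyperplanes orthogonal to the frequency. -/
lemma fourier_indicator_ball_single (n : ℕ) {R : ℝ} (hR : 0 < R) (l : ℝ) :
    𝓕 ((ball (0 : EuclideanSpace ℝ (Fin (n + 2))) R).indicator fun _ => (1 : ℂ))
        (EuclideanSpace.single 0 l) =
      volume.real (ball (0 : EuclideanSpace ℝ (Fin (n + 1))) 1) *
        ∫ t : ℝ, Complex.exp ((-2 * Real.pi * l * t : ℝ) * Complex.I) *
          (√(R ^ 2 - t ^ 2) ^ (n + 1) : ℝ) := by
  have hm1 := (volume_preserving_piFinSuccAbove (fun _ : Fin (n + 2) => ℝ) 0).symm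
  have hm2 := PiLp.volume_preserving_toLp (Fin (n + 2))
  have hm3 := PiLp.volume_preserving_toLp (Fin (n + 1))
  have he2 := (MeasurableEquiv.toLp 2 (Fin (n + 2) → ℝ)).measurableEmbedding
  have he3 := (MeasurableEquiv.toLp 2 (Fin (n + 1) → ℝ)).measurableEmbedding
  have he1 := (MeasurableEquiv.piFinSuccAbove (fun _ : Fin (n + 2) => ℝ) 0).symm.measurableEmbedding
  set F : EuclideanSpace ℝ (Fin (n + 2)) → ℂ := fun v =>
    Complex.exp ((-2 * Real.pi * l * v 0 : ℝ) * Complex.I) *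
      (ball (0 : EuclideanSpace ℝ (Fin (n + 2))) R).indicator (fun _ => (1 : ℂ)) v with hF
  have hFint : Integrable F := by
    refine (integrable_indicator_ball R).bdd_mul (c := 1)
      (Continuous.aestronglyMeasurable (by fun_prop)) (Eventually.of_forall fun v => ?_)
    rw [Complex.norm_exp_ofReal_mul_I]
  have hFi : 𝓕 ((ball (0 : EuclideanSpace ℝ (Fin (n + 2))) R).indicator fun _ => (1 : ℂ))
      (EuclideanSpace.single 0 l) = ∫ v, F v := by
    rw [Real.fourier_eq']
    congr 1
    ext v
    simp only [hF, smul_eq_mul, EuclideanSpace.inner_single_right]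
    congr 3
    simp
    ring
  have hslice : ∀ (t : ℝ) (y : Fin (n + 1) → ℝ),
      F (WithLp.toLp 2 ((MeasurableEquiv.piFinSuccAbove (fun _ : Fin (n + 2) => ℝ) 0).symm (t, y)))
        = Complex.exp ((-2 * Real.pi * l * t : ℝ) * Complex.I) *
          (ball (0 : EuclideanSpace ℝ (Fin (n + 1))) √(R ^ 2 - t ^ 2)).indicator (fun _ => (1 : ℂ))
            (WithLp.toLp 2 y) := by
    intro t y
    have hmem : WithLp.toLp 2 ((MeasurableEquiv.piFinSuccAbove
        (fun _ : Fin (n + 2) => ℝ) 0).symm (t, y)) ∈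
          ball (0 : EuclideanSpace ℝ (Fin (n + 2))) R ↔
        WithLp.toLp 2 y ∈ ball (0 : EuclideanSpace ℝ (Fin (n + 1))) √(R ^ 2 - t ^ 2) := by
      rw [mem_ball_zero_iff, mem_ball_zero_iff, Real.lt_sqrt (norm_nonneg _),
        ← sq_lt_sq₀ (norm_nonneg _) hR.le, EuclideanSpace.real_norm_sq_eq,
        EuclideanSpace.real_norm_sq_eq, Fin.sum_univ_succ]
      simp [MeasurableEquiv.piFinSuccAbove, lt_sub_iff_add_lt']
    have h0 : (MeasurableEquiv.piFinSuccAbove (fun _ : Fin (n + 2) => ℝ) 0).symm (t, y) 0 = t := by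
      simp [MeasurableEquiv.piFinSuccAbove]
    simp only [hF]
    refine congrArg₂ _ (by rw [h0]) ?_
    by_cases hy : WithLp.toLp 2 y ∈ ball (0 : EuclideanSpace ℝ (Fin (n + 1))) √(R ^ 2 - t ^ 2)
    · rw [Set.indicator_of_mem hy, Set.indicator_of_mem (hmem.2 hy)]
    · rw [Set.indicator_of_notMem hy, Set.indicator_of_notMem fun h => hy (hmem.1 h)]
  rw [hFi, ← hm2.integral_comp he2, ← hm1.integral_comp he1, Measure.volume_eq_prod, integral_prod,
    ← integral_const_mul]
  · congr 1
    ext t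
    simp only [hslice]
    rw [integral_const_mul, hm3.integral_comp he3 (fun y =>
      (ball (0 : EuclideanSpace ℝ (Fin (n + 1))) √(R ^ 2 - t ^ 2)).indicator (fun _ => (1 : ℂ)) y),
      integral_indicator_const _ measurableSet_ball, volume_real_ball_sqrt]
    simp only [Complex.real_smul]
    push_cast
    ring
  · exact (hm1.integrable_comp_emb he1).2 ((hm2.integrable_comp_emb he2).2 hFint)

lemma integral_exp_mul_sqrt_pow (n : ℕ) {R : ℝ} (hR : 0 < R) (c : ℝ) :
    ∫ t : ℝ, Complex.exp ((c * t : ℝ) * Complex.I) * (√(R ^ 2 - t ^ 2) ^ (n + 1) : ℝ) =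
      R ^ (n + 2) * cosIntegral (n + 2) (c * R) := by
  set G : ℝ → ℂ := fun t => Complex.exp ((c * t : ℝ) * Complex.I) *
    (√(R ^ 2 - t ^ 2) ^ (n + 1) : ℝ) with hG
  have hzero : ∀ t, t ∉ Set.Ioc (-R) R → G t = 0 := by
    intro t ht
    have : R ^ 2 - t ^ 2 ≤ 0 := by
      rw [Set.mem_Ioc, not_and_or, not_lt, not_le] at ht
      rcases ht with h | h <;> nlinarith
    simp [hG, Real.sqrt_eq_zero_of_nonpos this]
  rw [← setIntegral_eq_integral_of_forall_compl_eq_zero hzero,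
    ← intervalIntegral.integral_of_le (by linarith)]
  have hsub := intervalIntegral.integral_deriv_smul_comp (a := -(Real.pi / 2))
    (b := Real.pi / 2) (f := fun θ => R * Real.sin θ) (f' := fun θ => R * Real.cos θ) (g := G)
    (fun θ _ => (Real.hasDerivAt_sin θ).const_mul R) (by fun_prop) (by fun_prop)
  simp only [Real.sin_neg, Real.sin_pi_div_two, mul_neg, mul_one] at hsub
  rw [← hsub, cosIntegral, sineIntegral, ← intervalIntegral.integral_const_mul]
  refine intervalIntegral.integral_congr fun θ hθ => ?_
  rw [Set.uIcc_of_le (by linarith [Real.pi_pos])] at hθ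
  have hs : √(R ^ 2 - (R * Real.sin θ) ^ 2) = R * Real.cos θ := by
    rw [show R ^ 2 - (R * Real.sin θ) ^ 2 = (R * Real.cos θ) ^ 2 by
      linear_combination (-R ^ 2) * Real.sin_sq_add_cos_sq θ]
    exact Real.sqrt_sq (mul_nonneg hR.le (Real.cos_nonneg_of_mem_Icc hθ))
  simp only [Function.comp, hG, hs, sinePhase, Complex.real_smul]
  push_cast
  rw [show (c : ℂ) * (R * Complex.sin θ) = c * R * Complex.sin θ by ring]
  ring

lemma fourier_indicator_ball (n : ℕ) {R : ℝ} (hR : 0 < R)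
    (ξ : EuclideanSpace ℝ (Fin (n + 2))) :
    𝓕 ((ball (0 : EuclideanSpace ℝ (Fin (n + 2))) R).indicator fun _ => (1 : ℂ)) ξ =
      volume.real (ball (0 : EuclideanSpace ℝ (Fin (n + 1))) 1) *
        (R ^ (n + 2) * cosIntegral (n + 2) (-2 * Real.pi * ‖ξ‖ * R)) := by
  rw [fourier_indicator_ball_eq_of_norm_eq R (w := EuclideanSpace.single 0 ‖ξ‖) (by simp),
    fourier_indicator_ball_single n hR, integral_exp_mul_sqrt_pow n hR]

lemma fourier_indicator_shell {V : Type*} [NormedAddCommGroup V] [InnerProductSpace ℝ V]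
    [FiniteDimensional ℝ V] [Nontrivial V] [MeasurableSpace V] [BorelSpace V] {r R : ℝ}
    (h : r < R) (ξ : V) :
    𝓕 ({y : V | r < ‖y‖ ∧ ‖y‖ < R}.indicator fun _ => (1 : ℂ)) ξ =
      𝓕 ((ball (0 : V) R).indicator fun _ => (1 : ℂ)) ξ -
        𝓕 ((ball (0 : V) r).indicator fun _ => (1 : ℂ)) ξ := by
  have hint : ∀ s : ℝ, Integrable fun v : V => Complex.exp (↑(-2 * Real.pi * inner ℝ v ξ) *
      Complex.I) • (ball (0 : V) s).indicator (fun _ => (1 : ℂ)) v := fun s => by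
    refine (integrable_indicator_ball s).bdd_mul (c := 1)
      (Continuous.aestronglyMeasurable (by fun_prop)) (Eventually.of_forall fun v => ?_)
    rw [Complex.norm_exp_ofReal_mul_I]
  rw [Real.fourier_eq', Real.fourier_eq', Real.fourier_eq', ← integral_sub (hint R) (hint r)]
  refine integral_congr_ae ?_
  have hs : ∀ᵐ v : V, v ∉ sphere (0 : V) r := measure_eq_zero_iff_ae_notMem.1
    (Measure.addHaar_sphere volume 0 r)
  filter_upwards [hs] with v hv
  rw [mem_sphere_zero_iff_norm] at hv
  simp only [Set.indicator, Set.mem_ofPred_eq, mem_ball_zero_iff]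
  rcases lt_or_gt_of_ne hv with h1 | h1
  · simp [h1, h1.trans h, h1.le]
  · simp [h1, h1.not_gt]

lemma exists_norm_sub_mul_sqrt_pow_le (n : ℕ) :
    ∃ C : ℝ, 0 ≤ C ∧ ∀ l : ℝ, 0 ≤ l → ∀ r ∈ Set.Icc (1 / 2 : ℝ) (3 / 2),
      ∀ R ∈ Set.Icc (1 / 2 : ℝ) (3 / 2),
      ‖(R : ℂ) ^ (n + 2) * cosIntegral (n + 2) (-2 * Real.pi * l * R) -
        (r : ℂ) ^ (n + 2) * cosIntegral (n + 2) (-2 * Real.pi * l * r)‖ * √(1 + l) ^ (n + 1) ≤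
          C * |R - r| := by
  obtain ⟨C₁, hC₁, h₁⟩ := exists_norm_cosIntegral_mul_sqrt_pow_le (n + 2)
  obtain ⟨C₂, hC₂, h₂⟩ := exists_norm_cosIntegral_mul_sqrt_pow_le (n + 4)
  refine ⟨(n + 2) * 2 ^ (n + 1) * C₁ + 2 ^ (n + 2) * 2 * C₂, by positivity,
    fun l hl r hr R hR => ?_⟩
  set c := -2 * Real.pi * l with hc
  have hv : 0 < √(1 + l) ^ (n + 1) := by positivity
  have hderiv : ∀ s : ℝ, HasDerivAt
      (fun s : ℝ => (s : ℂ) ^ (n + 2) * cosIntegral (n + 2) (c * s))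
      ((n + 2) * (s : ℂ) ^ (n + 1) * cosIntegral (n + 2) (c * s) + (s : ℂ) ^ (n + 2) *
        (c * (-((c * s : ℝ) / ((n + 2 : ℕ) + 1)) * cosIntegral (n + 4) (c * s)))) s := by
    intro s
    have h := ((hasDerivAt_id s).ofReal_comp.fun_pow (n + 2)).fun_mul
      ((hasDerivAt_cosIntegral (n + 2) (c * s)).scomp s ((hasDerivAt_id s).const_mul c))
    refine h.congr_deriv ?_
    simp
  have hbound : ∀ s ∈ Set.Icc (1 / 2 : ℝ) (3 / 2),
      ‖(n + 2) * (s : ℂ) ^ (n + 1) * cosIntegral (n + 2) (c * s) + (s : ℂ) ^ (n + 2) *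
        (c * (-((c * s : ℝ) / ((n + 2 : ℕ) + 1)) * cosIntegral (n + 4) (c * s)))‖ ≤
      ((n + 2) * 2 ^ (n + 1) * C₁ + 2 ^ (n + 2) * 2 * C₂) / √(1 + l) ^ (n + 1) := by
    intro s hs
    rw [le_div_iff₀ hv]
    have hs0 : 0 ≤ s := by linarith [hs.1]
    have hs2 : s ≤ 2 := by linarith [hs.2]
    have hcabs : |c| = 2 * Real.pi * l := by
      rw [hc, abs_mul, abs_mul, abs_neg, abs_of_nonneg hl, abs_of_pos Real.pi_pos, abs_two]
    have hcs : |c * s| = |c| * s := by rw [abs_mul, abs_of_nonneg hs0]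
    set w := √(1 + |c * s|) with hw
    have hw2 : w ^ 2 = 1 + |c * s| := Real.sq_sqrt (by positivity)
    have hw1 : 1 ≤ w := Real.one_le_sqrt.2 (by linarith [abs_nonneg (c * s)])
    have hvw : √(1 + l) ≤ w := by
      refine Real.sqrt_le_sqrt ?_
      rw [hcs, hcabs]
      nlinarith [hs.1, Real.pi_gt_three, mul_nonneg hl Real.pi_pos.le]
    have hcw : |c| ≤ 2 * w ^ 2 := by
      rw [hw2, hcs]
      nlinarith [hs.1, abs_nonneg c]
    have hcsw : |c * s| ≤ w ^ 2 := by rw [hw2]; linarith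
    have n2 : ‖(n : ℂ) + 2‖ = n + 2 := by exact_mod_cast Complex.norm_natCast (n + 2)
    have n3 : ‖((n + 2 : ℕ) : ℂ) + 1‖ = n + 3 := by
      have := Complex.norm_natCast (n + 3)
      push_cast at this ⊢
      rw [← this]; congr 1; ring
    have hdiv : |c * s| / (n + 3) ≤ w ^ 2 :=
      (div_le_self (abs_nonneg _) (by linarith [Nat.cast_nonneg (α := ℝ) n])).trans hcsw
    refine (mul_le_mul (norm_add_le _ _) (pow_le_pow_left₀ (by positivity) hvw (n + 1))
      hv.le (by positivity)).trans ?_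
    simp only [norm_mul, norm_neg, norm_div, norm_pow, n2, n3, Complex.norm_real, Real.norm_eq_abs,
      abs_of_nonneg hs0]
    set A := ‖cosIntegral (n + 2) (c * s)‖
    set B := ‖cosIntegral (n + 4) (c * s)‖
    have hA : A * w ^ (n + 3) ≤ C₁ := h₁ (c * s)
    have hB : B * w ^ (n + 5) ≤ C₂ := h₂ (c * s)
    have hA' : A * w ^ (n + 1) ≤ C₁ := by
      refine le_trans ?_ hA
      gcongr
      norm_num
    rw [← abs_of_nonneg hs0, ← abs_mul, abs_of_nonneg hs0]
    calc ((n + 2) * s ^ (n + 1) * A + s ^ (n + 2) * (|c| * (|c * s| / (n + 3) * B))) * w ^ (n + 1)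
        ≤ ((n + 2) * 2 ^ (n + 1) * A + 2 ^ (n + 2) * (2 * w ^ 2 * (w ^ 2 * B))) * w ^ (n + 1) := by
          gcongr
      _ = (n + 2) * 2 ^ (n + 1) * (A * w ^ (n + 1)) + 2 ^ (n + 2) * 2 * (B * w ^ (n + 5)) := by
          ring
      _ ≤ _ := by gcongr
  have h := (convex_Icc (1 / 2 : ℝ) (3 / 2)).norm_image_sub_le_of_norm_hasDerivWithin_le
    (fun s _ => (hderiv s).hasDerivWithinAt) hbound hr hR
  rw [Real.norm_eq_abs, div_mul_eq_mul_div, le_div_iff₀ hv] at h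
  exact h

/-- For `d ≥ 2` there is a constant `C_d` such that for all `δ ∈ (0,1/2)` and `ξ ∈ ℝ^d`,
`|χ̂_{C^δ(0,1)}(ξ)| ≤ C_d δ (1+|ξ|)^{-(d-1)/2}`. -/
theorem fourier_indicator_annulus_decay_delta (d : ℕ) (hd : 2 ≤ d) :
    ∃ C : ℝ, 0 < C ∧ ∀ δ : ℝ, 0 < δ → δ < 1/2 → ∀ ξ : EuclideanSpace ℝ (Fin d),
      ‖𝓕 ((annulus d δ).indicator fun _ => (1:ℂ)) ξ‖ ≤
        C * δ * (1 + ‖ξ‖) ^ (-(((d:ℝ) - 1) / 2)) := by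
  obtain ⟨n, rfl⟩ := Nat.exists_eq_add_of_le' hd
  obtain ⟨C, hC, h⟩ := exists_norm_sub_mul_sqrt_pow_le n
  set ω := volume.real (ball (0 : EuclideanSpace ℝ (Fin (n + 1))) 1) with hω
  have hω0 : 0 ≤ ω := measureReal_nonneg
  refine ⟨ω * C * 2 + 1, by positivity, fun δ hδ hδ' ξ => ?_⟩
  have hv : 0 < √(1 + ‖ξ‖) ^ (n + 1) := by positivity
  have hpow : (1 + ‖ξ‖) ^ (-((((n + 2 : ℕ) : ℝ) - 1) / 2)) = (√(1 + ‖ξ‖) ^ (n + 1))⁻¹ := by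
    rw [Real.rpow_neg (by positivity), Real.sqrt_eq_rpow, ← Real.rpow_mul_natCast (by positivity)]
    congr 2
    push_cast
    ring
  rw [hpow, ← div_eq_mul_inv, le_div_iff₀ hv, annulus, fourier_indicator_shell (by linarith),
    fourier_indicator_ball n (by linarith), fourier_indicator_ball n (by linarith), ← mul_sub,
    norm_mul, Complex.norm_real, Real.norm_of_nonneg hω0, mul_assoc]
  have := h ‖ξ‖ (norm_nonneg ξ) (1 - δ) ⟨by linarith, by linarith⟩ (1 + δ)
    ⟨by linarith, by linarith⟩
  rw [show 1 + δ - (1 - δ) = 2 * δ by ring, abs_of_pos (by linarith)] at this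
  calc _ ≤ ω * (C * (2 * δ)) := mul_le_mul_of_nonneg_left this hω0
    _ ≤ _ := by linarith
end
end

section
/- Let d ≥ 2. There is a constant C_d such that for every δ ∈ (0,1/2) and every ξ ∈ ℝ^d, the Fourier transform of the indicator function of the annulus C^δ(0,1) satisfies |χ̂_{C^δ(0,1)}(ξ)| ≤ C_d (1+|ξ|)^{−(d+1)/2}. -/
open MeasureTheory Metric Filter
open scoped ENNReal FourierTransform Pointwise Topology

noncomputable section

theorem integral_rpow_mul_exp_neg_le {a l : ℝ} (ha : 0 < a) (hl : 0 ≤ l) :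
    ∫ y in (0:ℝ)..1, y ^ a * Real.exp (-(l * y)) ≤
      Real.exp 1 * Real.Gamma (a + 1) * (1 + l) ^ (-(a + 1)) := by
  have hl' : 0 < 1 + l := by linarith
  have h_int : IntegrableOn (fun y : ℝ => y ^ a * Real.exp (-((1 + l) * y))) (Set.Ioi 0) := by
    have := integrableOn_rpow_mul_exp_neg_mul_rpow (s := a) (p := 1) (by linarith) one_pos hl'
    simpa only [Real.rpow_one, neg_mul] using this
  have hG := Real.integral_rpow_mul_exp_neg_mul_Ioi (a := a + 1) (by linarith) hl'
  rw [add_sub_cancel_right] at hG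
  have hcont : ∀ c : ℝ, Continuous fun y : ℝ => y ^ a * Real.exp (-(c * y)) := fun c =>
    (Real.continuous_rpow_const ha.le).mul (by fun_prop)
  calc ∫ y in (0:ℝ)..1, y ^ a * Real.exp (-(l * y))
      ≤ ∫ y in (0:ℝ)..1, Real.exp 1 * (y ^ a * Real.exp (-((1 + l) * y))) := by
        refine intervalIntegral.integral_mono_on zero_le_one
          ((hcont l).intervalIntegrable _ _)
          (((hcont _).const_mul _).intervalIntegrable _ _) fun y hy => ?_
        have h1 : Real.exp (-(l * y)) ≤ Real.exp 1 * Real.exp (-((1 + l) * y)) := by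
          rw [← Real.exp_add]
          exact Real.exp_le_exp.2 (by linarith [hy.2])
        have := mul_le_mul_of_nonneg_left h1 (Real.rpow_nonneg hy.1 a)
        linarith
    _ = Real.exp 1 * ∫ y in Set.Ioc (0:ℝ) 1, y ^ a * Real.exp (-((1 + l) * y)) := by
        rw [intervalIntegral.integral_const_mul, intervalIntegral.integral_of_le zero_le_one]
    _ ≤ Real.exp 1 * ∫ y in Set.Ioi (0:ℝ), y ^ a * Real.exp (-((1 + l) * y)) := by
        refine mul_le_mul_of_nonneg_left ?_ (Real.exp_pos _).le
        refine setIntegral_mono_set h_int ?_ (Eventually.of_forall fun y hy => hy.1)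
        filter_upwards [ae_restrict_mem measurableSet_Ioi] with y hy
        exact mul_nonneg (Real.rpow_nonneg (le_of_lt hy) _) (Real.exp_pos _).le
    _ = _ := by
        rw [hG, one_div, Real.inv_rpow hl'.le, ← Real.rpow_neg hl'.le]
        ring

theorem exp_neg_le_integral_rpow_mul_exp_neg {a l : ℝ} (ha : 0 < a) (hl : 0 ≤ l) :
    Real.exp (-l) ≤ (a + 1) * ∫ y in (0:ℝ)..1, y ^ a * Real.exp (-(l * y)) := by
  have ha' : a + 1 ≠ 0 := by linarith
  have h : ∫ y in (0:ℝ)..1, y ^ a * Real.exp (-l) = Real.exp (-l) / (a + 1) := by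
    rw [intervalIntegral.integral_mul_const, integral_rpow (Or.inl (by linarith)),
      Real.one_rpow, Real.zero_rpow ha']
    ring
  have hle : ∫ y in (0:ℝ)..1, y ^ a * Real.exp (-l) ≤
      ∫ y in (0:ℝ)..1, y ^ a * Real.exp (-(l * y)) := by
    refine intervalIntegral.integral_mono_on zero_le_one
      (((Real.continuous_rpow_const ha.le).mul continuous_const).intervalIntegrable _ _)
      (((Real.continuous_rpow_const ha.le).mul (by fun_prop)).intervalIntegrable _ _)
      fun y hy => ?_
    refine mul_le_mul_of_nonneg_left (Real.exp_le_exp.2 ?_) (Real.rpow_nonneg hy.1 a)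
    nlinarith [hy.2]
  rw [h, div_le_iff₀' (by linarith)] at hle
  exact hle

/-- Decay of the one-dimensional oscillatory integral of `(r² - t²)^a`, obtained by shifting the
contour to the line `Im z = 1`. -/
theorem norm_integral_cpow_mul_exp_le {a : ℝ} (ha : 0 < a) :
    ∃ C : ℝ, 0 < C ∧ ∀ r : ℝ, 0 < r → r ≤ 3 / 2 → ∀ l : ℝ, 0 ≤ l →
      ‖∫ t in (-r)..r, ((r:ℂ) - t) ^ (a:ℂ) * ((r:ℂ) + t) ^ (a:ℂ) *
        Complex.exp (l * t * Complex.I)‖ ≤ C * (1 + l) ^ (-(a + 1)) := by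
  refine ⟨(4 ^ a * 4 ^ a * 3 * (a + 1) + 2 * 4 ^ a) * (Real.exp 1 * Real.Gamma (a + 1)),
    by have := Real.Gamma_pos_of_pos (s := a + 1) (by linarith); positivity, ?_⟩
  intro r hr hr' l hl
  set F : ℂ → ℂ := fun z => ((r:ℂ) - z) ^ (a:ℂ) * ((r:ℂ) + z) ^ (a:ℂ) *
    Complex.exp (l * z * Complex.I) with hF
  have hFn : ∀ z, ‖F z‖ = ‖(r:ℂ) - z‖ ^ a * ‖(r:ℂ) + z‖ ^ a * Real.exp (-(l * z.im)) := by
    intro z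
    simp only [hF, norm_mul, Complex.norm_cpow_real, Complex.norm_exp]
    simp
  have hc : ContinuousOn F (Set.uIcc (-r) r ×ℂ Set.uIcc 0 1) := by
    rw [Set.uIcc_of_le (by linarith), Set.uIcc_of_le zero_le_one]
    intro z hz
    obtain ⟨h1, h2⟩ := Complex.mem_reProdIm.1 hz
    apply ContinuousAt.continuousWithinAt
    have hcp : ∀ w : ℂ, 0 ≤ w.re → ContinuousAt (fun x : ℂ => x ^ (a:ℂ)) w := fun w hw =>
      Complex.continuousAt_cpow_const_of_re_pos (Or.inl hw) (by simpa using ha)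
    have e1 : ContinuousAt (fun z : ℂ => ((r:ℂ) - z) ^ (a:ℂ)) z :=
      ContinuousAt.comp (f := fun z : ℂ => (r:ℂ) - z) (hcp _ (by simpa using h1.2))
        (by fun_prop)
    have e2 : ContinuousAt (fun z : ℂ => ((r:ℂ) + z) ^ (a:ℂ)) z :=
      ContinuousAt.comp (f := fun z : ℂ => (r:ℂ) + z)
        (hcp _ (by simp only [Complex.add_re, Complex.ofReal_re]; linarith [h1.1]))
        (by fun_prop)
    exact (e1.mul e2).mul (by fun_prop)
  have hd : DifferentiableOn ℂ F (Set.Ioo (min (-r) r) (max (-r) r) ×ℂ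
      Set.Ioo (min 0 1) (max 0 1)) := by
    rw [min_eq_left (by linarith), max_eq_right (by linarith)]
    intro z hz
    obtain ⟨h1, h2⟩ := Complex.mem_reProdIm.1 hz
    apply DifferentiableAt.differentiableWithinAt
    have s1 : (r:ℂ) - z ∈ Complex.slitPlane := Or.inl (by simpa using h1.2)
    have s2 : (r:ℂ) + z ∈ Complex.slitPlane :=
      Or.inl (by simp only [Complex.add_re, Complex.ofReal_re]; linarith [h1.1])
    have e1 : DifferentiableAt ℂ (fun z : ℂ => ((r:ℂ) - z) ^ (a:ℂ)) z :=
      DifferentiableAt.cpow_const (by fun_prop) s1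
    have e2 : DifferentiableAt ℂ (fun z : ℂ => ((r:ℂ) + z) ^ (a:ℂ)) z :=
      DifferentiableAt.cpow_const (by fun_prop) s2
    exact (e1.mul e2).mul (by fun_prop)
  have key := Complex.integral_boundary_rect_eq_zero_of_continuousOn_of_differentiableOn F
    ((-r : ℝ) : ℂ) ((r:ℂ) + Complex.I) (by simpa using hc) (by simpa using hd)
  simp only [Complex.ofReal_re, Complex.ofReal_im, Complex.add_re, Complex.add_im, Complex.I_re,
    Complex.I_im, add_zero, zero_add, Complex.ofReal_zero, zero_mul, Complex.ofReal_one,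
    one_mul] at key
  set J := ∫ y in (0:ℝ)..1, y ^ a * Real.exp (-(l * y)) with hJ
  have hJint : IntervalIntegrable (fun y : ℝ => 4 ^ a * (y ^ a * Real.exp (-(l * y))))
      volume 0 1 :=
    (continuous_const.mul ((Real.continuous_rpow_const ha.le).mul
      (by fun_prop))).intervalIntegrable _ _
  have top : ‖∫ x in (-r)..r, F (x + Complex.I)‖ ≤ 4 ^ a * 4 ^ a * 3 * Real.exp (-l) := by
    have hb : ∀ x ∈ Set.uIoc (-r) r,
        ‖F (x + Complex.I)‖ ≤ 4 ^ a * 4 ^ a * Real.exp (-l) := by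
      intro x hx
      rw [Set.uIoc_of_le (by linarith)] at hx
      rw [hFn]
      have n1 : ‖(r:ℂ) - (x + Complex.I)‖ ≤ 4 := by
        have : (r:ℂ) - (x + Complex.I) = ((r - x : ℝ) : ℂ) - Complex.I := by push_cast; ring
        rw [this]
        refine (norm_sub_le _ _).trans ?_
        rw [Complex.norm_real, Complex.norm_I, Real.norm_eq_abs, abs_of_nonneg (by linarith [hx.2])]
        linarith [hx.1]
      have n2 : ‖(r:ℂ) + (x + Complex.I)‖ ≤ 4 := by
        have : (r:ℂ) + (x + Complex.I) = ((r + x : ℝ) : ℂ) + Complex.I := by push_cast; ring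
        rw [this]
        refine (norm_add_le _ _).trans ?_
        rw [Complex.norm_real, Complex.norm_I, Real.norm_eq_abs, abs_of_nonneg (by linarith [hx.1])]
        linarith [hx.2]
      have : (x + Complex.I : ℂ).im = 1 := by simp
      rw [this, mul_one]
      gcongr
    refine (intervalIntegral.norm_integral_le_of_norm_le_const hb).trans ?_
    rw [abs_of_nonneg (by linarith)]
    have : (0:ℝ) ≤ 4 ^ a * 4 ^ a * Real.exp (-l) := by positivity
    nlinarith
  have side : ∀ c : ℝ, (c = r ∨ c = -r) → ‖∫ y in (0:ℝ)..1, F (c + y * Complex.I)‖ ≤ 4 ^ a * J := by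
    intro c hcr
    rw [hJ, ← intervalIntegral.integral_const_mul]
    refine intervalIntegral.norm_integral_le_of_norm_le zero_le_one
      (Eventually.of_forall fun y hy => ?_) hJint
    rw [hFn]
    have him : (c + y * Complex.I : ℂ).im = y := by simp
    rw [him]
    have hy1 : ∀ s : ℝ, (s = 1 ∨ s = -1) → ‖(s:ℂ) * (y * Complex.I)‖ = y := by
      rintro s (rfl | rfl) <;> simp [abs_of_pos hy.1]
    have hy2 : ∀ s : ℝ, (s = 1 ∨ s = -1) → ‖((2 * r : ℝ) : ℂ) + (s:ℂ) * (y * Complex.I)‖ ≤ 4 := by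
      intro s hs
      refine (norm_add_le _ _).trans ?_
      rw [hy1 s hs, Complex.norm_real, Real.norm_eq_abs, abs_of_nonneg (by linarith)]
      linarith [hy.2]
    have hyn := hy.1.le
    rcases hcr with rfl | rfl
    · have e1 : (c:ℂ) - (c + y * Complex.I) = ((-1:ℝ):ℂ) * (y * Complex.I) := by push_cast; ring
      have e2 : (c:ℂ) + (c + y * Complex.I) = ((2 * c : ℝ) : ℂ) + ((1:ℝ):ℂ) * (y * Complex.I) := by
        push_cast; ring
      rw [e1, e2, hy1 _ (Or.inr rfl)]
      calc _ ≤ y ^ a * 4 ^ a * Real.exp (-(l * y)) := by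
            have := hy2 1 (Or.inl rfl)
            gcongr
        _ = _ := by ring
    · have e1 : (r:ℂ) - ((-r : ℝ) + y * Complex.I) =
          ((2 * r : ℝ) : ℂ) + ((-1:ℝ):ℂ) * (y * Complex.I) := by push_cast; ring
      have e2 : (r:ℂ) + ((-r : ℝ) + y * Complex.I) = ((1:ℝ):ℂ) * (y * Complex.I) := by
        push_cast; ring
      rw [e1, e2, hy1 _ (Or.inl rfl)]
      calc _ ≤ 4 ^ a * y ^ a * Real.exp (-(l * y)) := by
            have := hy2 (-1) (Or.inr rfl)
            gcongr
        _ = _ := by ring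
  have hexp := exp_neg_le_integral_rpow_mul_exp_neg ha hl
  have hJle := integral_rpow_mul_exp_neg_le ha hl
  rw [← hJ] at hexp hJle
  have heq : ∫ t in (-r)..r, F t = (∫ x in (-r)..r, F (x + Complex.I)) +
      (Complex.I • (∫ y in (0:ℝ)..1, F ((-r : ℝ) + y * Complex.I)) -
      Complex.I • ∫ y in (0:ℝ)..1, F (r + y * Complex.I)) := by
    linear_combination key
  change ‖∫ t in (-r)..r, F t‖ ≤ _
  rw [heq]
  have s1 := side r (Or.inl rfl)
  have s2 := side (-r) (Or.inr rfl)
  calc _ ≤ 4 ^ a * 4 ^ a * 3 * Real.exp (-l) + (4 ^ a * J + 4 ^ a * J) := by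
        refine (norm_add_le _ _).trans ?_
        gcongr
        refine (norm_sub_le _ _).trans ?_
        rw [norm_smul, norm_smul, Complex.norm_I, one_mul, one_mul]
        gcongr
    _ ≤ (4 ^ a * 4 ^ a * 3 * (a + 1) + 2 * 4 ^ a) * J := by
        have : (0:ℝ) ≤ 4 ^ a * 4 ^ a * 3 := by positivity
        nlinarith [mul_le_mul_of_nonneg_left hexp this]
    _ ≤ (4 ^ a * 4 ^ a * 3 * (a + 1) + 2 * 4 ^ a) *
          (Real.exp 1 * Real.Gamma (a + 1) * (1 + l) ^ (-(a + 1))) := by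
        gcongr
    _ = _ := by ring

/-- The volume of a Euclidean ball, read off in coordinates. -/
theorem volume_real_setOf_norm_toLp_lt {n : ℕ} (hn : 1 ≤ n) {ρ : ℝ} (hρ : 0 ≤ ρ) :
    volume.real {y : Fin n → ℝ | ‖WithLp.toLp 2 y‖ < ρ} =
      ρ ^ n * volume.real (ball (0 : EuclideanSpace ℝ (Fin n)) 1) := by
  have : NeZero n := ⟨by omega⟩
  have h1 : {y : Fin n → ℝ | ‖WithLp.toLp 2 y‖ < ρ} =
      WithLp.toLp 2 ⁻¹' (ball (0 : EuclideanSpace ℝ (Fin n)) ρ) := by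
    ext y; simp
  rw [h1, measureReal_def, (PiLp.volume_preserving_toLp (Fin n)).measure_preimage
    measurableSet_ball.nullMeasurableSet, Measure.addHaar_ball _ _ hρ, ENNReal.toReal_mul,
    ENNReal.toReal_ofReal (by positivity), finrank_euclideanSpace_fin, measureReal_def]

/-- Slicing a ball by the hyperplanes orthogonal to the first coordinate axis. -/
theorem setIntegral_ball_comp_coord_zero {n : ℕ} (hn : 1 ≤ n) {r : ℝ} (hr : 0 < r) {g : ℝ → ℂ}
    (hg : Continuous g) :
    ∫ x in ball (0 : EuclideanSpace ℝ (Fin (n + 1))) r, g (x 0) =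
      ∫ t in (-r)..r, (((√(r ^ 2 - t ^ 2)) ^ n *
        volume.real (ball (0 : EuclideanSpace ℝ (Fin n)) 1) : ℝ) : ℂ) * g t := by
  set e : EuclideanSpace ℝ (Fin (n + 1)) ≃ᵐ ℝ × (Fin n → ℝ) :=
    (MeasurableEquiv.toLp 2 (Fin (n + 1) → ℝ)).symm.trans
      (MeasurableEquiv.piFinSuccAbove (fun _ => ℝ) 0) with he
  have hmp : MeasurePreserving e volume volume :=
    (volume_preserving_piFinSuccAbove (fun _ : Fin (n + 1) => ℝ) 0).comp
      (EuclideanSpace.volume_preserving_symm_measurableEquiv_toLp (Fin (n + 1)))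
  set V := volume.real (ball (0 : EuclideanSpace ℝ (Fin n)) 1)
  set S : ℝ → Set (Fin n → ℝ) := fun t => {y | ‖WithLp.toLp 2 y‖ < √(r ^ 2 - t ^ 2)} with hS
  set G : ℝ × (Fin n → ℝ) → ℂ := fun p => (S p.1).indicator (fun _ => g p.1) p.2 with hG
  have hSm : ∀ t, MeasurableSet (S t) := fun t =>
    (isOpen_lt (by fun_prop) continuous_const).measurableSet
  have hGe : ∀ x, G (e x) =
      (ball (0 : EuclideanSpace ℝ (Fin (n + 1))) r).indicator (fun x => g (x 0)) x := by
    classical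
    intro x
    have hx : e x = (x 0, fun j => x j.succ) := by
      rw [he]; rfl
    have hiff : (fun j => x (Fin.succ j)) ∈ S (x 0) ↔
        x ∈ ball (0 : EuclideanSpace ℝ (Fin (n + 1))) r := by
      rw [mem_ball_zero_iff, EuclideanSpace.norm_eq, hS, Set.mem_ofPred_eq,
        EuclideanSpace.norm_eq, Real.sqrt_lt_sqrt_iff (by positivity), Real.sqrt_lt' hr,
        Fin.sum_univ_succ]
      simp only [Real.norm_eq_abs, sq_abs]
      constructor <;> intro h <;> linarith
    simp only [hx, hG, Set.indicator_apply, hiff]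
  have h_int : Integrable G (volume.prod volume) := by
    rw [← Measure.volume_eq_prod, ← hmp.integrable_comp_emb e.measurableEmbedding]
    have : G ∘ e = (ball (0 : EuclideanSpace ℝ (Fin (n + 1))) r).indicator
      (fun x => g (x 0)) := funext hGe
    rw [this, integrable_indicator_iff measurableSet_ball]
    refine IntegrableOn.mono_set (ContinuousOn.integrableOn_compact
      (isCompact_closedBall (0 : EuclideanSpace ℝ (Fin (n + 1))) r) ?_) ball_subset_closedBall
    exact (hg.comp (by fun_prop)).continuousOn
  rw [← integral_indicator measurableSet_ball]
  simp_rw [← hGe]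
  rw [hmp.integral_comp e.measurableEmbedding, Measure.volume_eq_prod, integral_prod _ h_int]
  have hinner : ∀ t, ∫ y, G (t, y) = (((√(r ^ 2 - t ^ 2)) ^ n * V : ℝ) : ℂ) * g t := by
    intro t
    simp only [hG]
    rw [integral_indicator (hSm t), setIntegral_const,
      volume_real_setOf_norm_toLp_lt hn (Real.sqrt_nonneg _), Complex.real_smul]
  simp_rw [hinner]
  rw [intervalIntegral.integral_of_le (by linarith)]
  refine (setIntegral_eq_integral_of_forall_compl_eq_zero fun t ht => ?_).symm
  have : √(r ^ 2 - t ^ 2) = 0 := by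
    apply Real.sqrt_eq_zero_of_nonpos
    rw [Set.mem_Ioc, not_and_or, not_lt, not_le] at ht
    rcases ht with h | h <;> nlinarith
  rw [this, zero_pow (by omega)]
  simp

theorem sqrt_pow_eq_cpow_mul_cpow {n : ℕ} {r t : ℝ} (ht : t ∈ Set.Icc (-r) r) :
    (((√(r ^ 2 - t ^ 2)) ^ n : ℝ) : ℂ) =
      ((r:ℂ) - t) ^ (((n:ℝ) / 2 : ℝ) : ℂ) * ((r:ℂ) + t) ^ (((n:ℝ) / 2 : ℝ) : ℂ) := by
  have h1 : 0 ≤ r - t := by linarith [ht.2]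
  have h2 : 0 ≤ r + t := by linarith [ht.1]
  rw [← Complex.ofReal_sub, ← Complex.ofReal_add, ← Complex.ofReal_cpow h1,
    ← Complex.ofReal_cpow h2, ← Complex.ofReal_mul, ← Real.mul_rpow h1 h2,
    Real.sqrt_eq_rpow, ← Real.rpow_natCast, ← Real.rpow_mul (by nlinarith)]
  congr 2 <;> ring

/-- Fourier decay of balls, uniformly for radii at most `3 / 2`. -/
theorem norm_fourier_indicator_ball_le {n : ℕ} (hn : 1 ≤ n) :
    ∃ C : ℝ, 0 < C ∧ ∀ r : ℝ, 0 < r → r ≤ 3 / 2 → ∀ ξ : EuclideanSpace ℝ (Fin (n + 1)),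
      ‖𝓕 ((ball (0 : EuclideanSpace ℝ (Fin (n + 1))) r).indicator fun _ => (1:ℂ)) ξ‖ ≤
        C * (1 + ‖ξ‖) ^ (-((n:ℝ) / 2 + 1)) := by
  have ha : (0:ℝ) < n / 2 := by positivity
  obtain ⟨C, hC, H⟩ := norm_integral_cpow_mul_exp_le ha
  have hVpos : 0 < volume.real (ball (0 : EuclideanSpace ℝ (Fin n)) 1) :=
    ENNReal.toReal_pos (measure_ball_pos _ _ one_pos).ne' measure_ball_lt_top.ne
  set V := volume.real (ball (0 : EuclideanSpace ℝ (Fin n)) 1) with hV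
  refine ⟨V * C, by positivity, fun r hr hr' ξ => ?_⟩
  set w : EuclideanSpace ℝ (Fin (n + 1)) := EuclideanSpace.single 0 (-‖ξ‖) with hw
  have hnorm : ‖w‖ = ‖ξ‖ := by simp [hw]
  set A := (ℝ ∙ (w - ξ))ᗮ.reflection with hA
  have hAw : A w = ξ := Submodule.reflection_sub hnorm
  have hcomp : ((ball (0 : EuclideanSpace ℝ (Fin (n + 1))) r).indicator fun _ => (1:ℂ)) ∘ A =
      (ball (0 : EuclideanSpace ℝ (Fin (n + 1))) r).indicator fun _ => (1:ℂ) := by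
    classical
    ext x
    simp [Set.indicator_apply]
  have hF : 𝓕 ((ball (0 : EuclideanSpace ℝ (Fin (n + 1))) r).indicator fun _ => (1:ℂ)) ξ =
      V * ∫ t in (-r)..r, ((r:ℂ) - t) ^ (((n:ℝ) / 2 : ℝ) : ℂ) *
        ((r:ℂ) + t) ^ (((n:ℝ) / 2 : ℝ) : ℂ) *
        Complex.exp (((2 * Real.pi * ‖ξ‖ : ℝ) : ℂ) * t * Complex.I) := by
    rw [← hAw, ← Real.fourier_comp_linearIsometry, hcomp, Real.fourier_eq', hAw]
    have hg : Continuous fun t : ℝ =>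
      Complex.exp (((2 * Real.pi * ‖ξ‖ : ℝ) : ℂ) * t * Complex.I) := by fun_prop
    have hslice := setIntegral_ball_comp_coord_zero hn hr hg
    rw [← integral_indicator measurableSet_ball] at hslice
    have hleft : ∀ x : EuclideanSpace ℝ (Fin (n + 1)),
        Complex.exp (((-2 * Real.pi * inner ℝ x w : ℝ) : ℂ) * Complex.I) •
          (ball (0 : EuclideanSpace ℝ (Fin (n + 1))) r).indicator (fun _ => (1:ℂ)) x =
        (ball (0 : EuclideanSpace ℝ (Fin (n + 1))) r).indicator (fun x =>
          Complex.exp (((2 * Real.pi * ‖ξ‖ : ℝ) : ℂ) * (x 0 : ℝ) * Complex.I)) x := by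
      classical
      intro x
      have hin : inner ℝ x w = -‖ξ‖ * x 0 := by
        rw [hw, EuclideanSpace.inner_single_right]; simp
      simp only [Set.indicator_apply, hin]
      split_ifs
      · simp only [smul_eq_mul, mul_one]
        congr 1
        push_cast
        ring
      · simp
    simp_rw [hleft]
    rw [hslice, ← intervalIntegral.integral_const_mul]
    refine intervalIntegral.integral_congr fun t ht => ?_
    rw [Set.uIcc_of_le (by linarith)] at ht
    rw [Complex.ofReal_mul, sqrt_pow_eq_cpow_mul_cpow ht]
    ring
  rw [hF, norm_mul, Complex.norm_real, Real.norm_of_nonneg hVpos.le, mul_assoc V C]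
  refine mul_le_mul_of_nonneg_left ((H r hr hr' _ (by positivity)).trans ?_) hVpos.le
  refine mul_le_mul_of_nonneg_left
    (Real.rpow_le_rpow_of_nonpos (by positivity) ?_ (by linarith)) hC.le
  nlinarith [Real.pi_gt_three, norm_nonneg ξ]

theorem indicator_annulus_ae_eq (n : ℕ) {δ : ℝ} (hδ : 0 < δ) :
    (annulus (n + 1) δ).indicator (fun _ => (1:ℂ)) =ᵐ[volume]
      (ball (0 : EuclideanSpace ℝ (Fin (n + 1))) (1 + δ)).indicator (fun _ => (1:ℂ)) -
        (ball (0 : EuclideanSpace ℝ (Fin (n + 1))) (1 - δ)).indicator (fun _ => (1:ℂ)) := by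
  have hs : ∀ᵐ x : EuclideanSpace ℝ (Fin (n + 1)), x ∉ sphere 0 (1 - δ) :=
    measure_eq_zero_iff_ae_notMem.1 (Measure.addHaar_sphere volume 0 (1 - δ))
  classical
  filter_upwards [hs] with x hx
  rw [mem_sphere_zero_iff_norm] at hx
  simp only [annulus, Set.indicator_apply, Pi.sub_apply, Set.mem_ofPred_eq, mem_ball_zero_iff]
  rcases lt_or_gt_of_ne hx with h | h
  · rw [if_neg (by intro h'; linarith [h'.1]), if_pos (by linarith), if_pos h, sub_self]
  · rw [if_neg (not_lt.2 h.le), sub_zero]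
    simp [h]

/-- For `d ≥ 2` there is a constant `C_d` such that for all `δ ∈ (0,1/2)` and `ξ ∈ ℝ^d`,
`|χ̂_{C^δ(0,1)}(ξ)| ≤ C_d (1+|ξ|)^{-(d+1)/2}`. -/
theorem fourier_indicator_annulus_decay (d : ℕ) (hd : 2 ≤ d) :
    ∃ C : ℝ, 0 < C ∧ ∀ δ : ℝ, 0 < δ → δ < 1/2 → ∀ ξ : EuclideanSpace ℝ (Fin d),
      ‖𝓕 ((annulus d δ).indicator fun _ => (1:ℂ)) ξ‖ ≤
        C * (1 + ‖ξ‖) ^ (-(((d:ℝ) + 1) / 2)) := by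
  obtain ⟨n, rfl⟩ : ∃ n, d = n + 1 := ⟨d - 1, by omega⟩
  obtain ⟨C, hC, H⟩ := norm_fourier_indicator_ball_le (n := n) (by omega)
  refine ⟨2 * C, by positivity, fun δ h0 h1 ξ => ?_⟩
  have h_int : ∀ r : ℝ, Integrable
      ((ball (0 : EuclideanSpace ℝ (Fin (n + 1))) r).indicator (fun _ => (1:ℂ))) := fun r =>
    (integrable_indicator_iff measurableSet_ball).2 (integrableOn_const measure_ball_lt_top.ne)
  have hsub : 𝓕 ((annulus (n + 1) δ).indicator fun _ => (1:ℂ)) ξ =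
      𝓕 ((ball (0 : EuclideanSpace ℝ (Fin (n + 1))) (1 + δ)).indicator fun _ => (1:ℂ)) ξ -
      𝓕 ((ball (0 : EuclideanSpace ℝ (Fin (n + 1))) (1 - δ)).indicator fun _ => (1:ℂ)) ξ := by
    simp only [Real.fourier_eq]
    rw [← integral_sub ((Real.fourierIntegral_convergent_iff ξ).2 (h_int _))
      ((Real.fourierIntegral_convergent_iff ξ).2 (h_int _))]
    refine integral_congr_ae ?_
    filter_upwards [indicator_annulus_ae_eq n h0] with x hx
    rw [hx, Pi.sub_apply, smul_sub]
  have hexp : -((((n + 1 : ℕ) : ℝ) + 1) / 2) = -((n:ℝ) / 2 + 1) := by push_cast; ring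
  rw [hsub, hexp]
  refine (norm_sub_le _ _).trans ?_
  have b1 := H (1 + δ) (by linarith) (by linarith) ξ
  have b2 := H (1 - δ) (by linarith) (by linarith) ξ
  linarith
end
end

section
/- Let d ≥ 2. There is a constant C_d such that for every δ ∈ (0,1/2) and every ξ ∈ ℝ^d, the normalised Fourier transform of the indicator of the annulus C^δ(0,1) satisfies |χ̂_{C^δ(0,1)}(ξ)| / |C^δ(0,1)| ≤ C_d δ^{−1/2} (1+|ξ|)^{−d/2}. -/
open MeasureTheory Metric Filter
open scoped ENNReal FourierTransform Pointwise Topology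

noncomputable section

/-- The cosine transform of `(1 - t²)^(n/2)` on `[-1, 1]`. -/
def capCos (n : ℕ) (s : ℝ) : ℝ := ∫ t in (-1 : ℝ)..1, √(1 - t ^ 2) ^ n * Real.cos (s * t)

/-- The negative of the derivative of `capCos n`. -/
def capSin (n : ℕ) (s : ℝ) : ℝ :=
  ∫ t in (-1 : ℝ)..1, √(1 - t ^ 2) ^ n * t * Real.sin (s * t)

theorem hasDerivAt_integral_mul_comp_mul {w φ φ' : ℝ → ℝ} (hw : Continuous w)
    (hφ : ∀ x, HasDerivAt φ (φ' x) x) (hφ' : Continuous φ') (hb : ∀ x, |φ' x| ≤ 1) (a b s : ℝ) :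
    HasDerivAt (fun s => ∫ t in a..b, w t * φ (s * t)) (∫ t in a..b, w t * t * φ' (s * t)) s := by
  have hφc : Continuous φ := continuous_iff_continuousAt.2 fun x => (hφ x).continuousAt
  refine (intervalIntegral.hasDerivAt_integral_of_dominated_loc_of_deriv_le
    (F := fun s t => w t * φ (s * t)) (F' := fun s t => w t * t * φ' (s * t))
    (bound := fun t => |w t * t|) (s := Set.univ) univ_mem ?_ ?_ ?_ ?_ ?_ ?_).2
  · exact Eventually.of_forall fun x => Continuous.aestronglyMeasurable (by fun_prop)
  · exact Continuous.intervalIntegrable (by fun_prop) _ _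
  · exact Continuous.aestronglyMeasurable (by fun_prop)
  · refine Eventually.of_forall fun t _ x _ => ?_
    rw [Real.norm_eq_abs, abs_mul]
    exact mul_le_of_le_one_right (abs_nonneg _) (hb _)
  · exact Continuous.intervalIntegrable (by fun_prop) _ _
  · refine Eventually.of_forall fun t _ x _ => ?_
    have h := ((hφ (x * t)).comp x ((hasDerivAt_id x).mul_const t)).const_mul (w t)
    exact h.congr_deriv (by simp only [one_mul]; ring)

theorem hasDerivAt_capCos (n : ℕ) (s : ℝ) : HasDerivAt (capCos n) (-capSin n s) s := by
  have h := hasDerivAt_integral_mul_comp_mul (w := fun t => √(1 - t ^ 2) ^ n) (by fun_prop)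
    Real.hasDerivAt_cos (by fun_prop) (fun x => by simpa using Real.abs_sin_le_one x) (-1) 1 s
  simp only [mul_neg, intervalIntegral.integral_neg] at h
  exact h

theorem hasDerivAt_capSin (n : ℕ) (s : ℝ) :
    HasDerivAt (capSin n)
      (∫ t in (-1 : ℝ)..1, √(1 - t ^ 2) ^ n * t * t * Real.cos (s * t)) s :=
  hasDerivAt_integral_mul_comp_mul (w := fun t => √(1 - t ^ 2) ^ n * t) (by fun_prop)
    Real.hasDerivAt_sin (by fun_prop) Real.abs_cos_le_one (-1) 1 s

theorem mul_capCos_sub (n : ℕ) (s : ℝ) :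
    s * (capCos n s - ∫ t in (-1 : ℝ)..1, √(1 - t ^ 2) ^ n * t * t * Real.cos (s * t)) =
      (n + 2) * capSin n s := by
  have key := intervalIntegral.integral_eq_sub_of_hasDerivAt_of_le (a := -1) (b := 1)
    (f := fun t => √(1 - t ^ 2) ^ (n + 2) * Real.sin (s * t))
    (f' := fun t => s * (√(1 - t ^ 2) ^ n * Real.cos (s * t)
      - √(1 - t ^ 2) ^ n * t * t * Real.cos (s * t))
      - (n + 2) * (√(1 - t ^ 2) ^ n * t * Real.sin (s * t)))
    (by norm_num) (Continuous.continuousOn (by fun_prop)) (fun t ht => ?_)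
    (Continuous.intervalIntegrable (by fun_prop) _ _)
  · rw [intervalIntegral.integral_sub (Continuous.intervalIntegrable (by fun_prop) _ _)
      (Continuous.intervalIntegrable (by fun_prop) _ _), intervalIntegral.integral_const_mul,
      intervalIntegral.integral_const_mul,
      intervalIntegral.integral_sub (Continuous.intervalIntegrable (by fun_prop) _ _)
      (Continuous.intervalIntegrable (by fun_prop) _ _)] at key
    simp only [capCos, capSin]
    norm_num at key
    linarith
  · have hpos : 0 < 1 - t ^ 2 := by nlinarith [ht.1, ht.2]
    have hs : √(1 - t ^ 2) ^ 2 = 1 - t ^ 2 := Real.sq_sqrt hpos.le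
    have hne : √(1 - t ^ 2) ≠ 0 := (Real.sqrt_pos.2 hpos).ne'
    have h1 : HasDerivAt (fun t : ℝ => 1 - t ^ 2) (-(2 * t)) t := by
      simpa using (hasDerivAt_pow 2 t).const_sub 1
    have h2 := ((h1.sqrt hpos.ne').fun_pow (n + 2)).fun_mul
      ((Real.hasDerivAt_sin (s * t)).comp t ((hasDerivAt_id t).const_mul s))
    refine h2.congr_deriv ?_
    have e1 : n + 2 - 1 = n + 1 := rfl
    simp only [Function.comp, e1]
    rw [pow_add _ n 2, hs, pow_succ]
    field_simp
    push_cast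
    ring

/-- Solutions of the Bessel-type equation `f'' + (2b/s) f' + f = 0` decay, with their derivative,
like `s ^ (-b)`. -/
theorem exists_rpow_mul_le_of_bessel {f S Q : ℝ → ℝ} {b : ℝ} (hb : 0 ≤ b)
    (hf : ∀ s, HasDerivAt f (-S s) s) (hS : ∀ s, HasDerivAt S (Q s) s)
    (hQ : ∀ s, s * (f s - Q s) = 2 * b * S s) :
    ∃ K, 0 < K ∧ ∀ s, 1 ≤ s → s ^ b * |f s| ≤ K ∧ s ^ b * |S s| ≤ K := by
  set c : ℝ := |b * (b - 1)| with hc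
  set u : ℝ → ℝ := fun s => s ^ b * f s with hu
  set v : ℝ → ℝ := fun s => b * (u s / s) - s ^ b * S s with hv
  have hu' : ∀ s, 0 < s → HasDerivAt u (v s) s := by
    intro s hs
    refine ((Real.hasDerivAt_rpow_const (p := b) (Or.inl hs.ne')).fun_mul (hf s)).congr_deriv ?_
    simp only [hv, hu]
    rw [Real.rpow_sub_one hs.ne']
    ring
  have hv' : ∀ s, 0 < s → HasDerivAt v ((b * (b - 1) / s ^ 2 - 1) * u s) s := by
    intro s hs
    refine ((((hu' s hs).fun_div (hasDerivAt_id s) hs.ne').const_mul b).fun_sub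
      ((Real.hasDerivAt_rpow_const (p := b) (Or.inl hs.ne')).fun_mul (hS s))).congr_deriv ?_
    have hq : Q s = f s - 2 * b * S s / s := by
      rw [← hQ s]; field_simp; ring
    simp only [hv, hu, id]
    rw [Real.rpow_sub_one hs.ne', hq]
    field_simp
    ring
  set E : ℝ → ℝ := fun s => (u s ^ 2 + v s ^ 2) * Real.exp (c / s) with hE
  have hE' : ∀ s, 0 < s → HasDerivAt E
      ((2 * (b * (b - 1)) * (u s * v s) - c * (u s ^ 2 + v s ^ 2)) / s ^ 2
        * Real.exp (c / s)) s := by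
    intro s hs
    have h1 : HasDerivAt (fun s : ℝ => c / s) (-c / s ^ 2) s := by
      refine ((hasDerivAt_const s c).fun_div (hasDerivAt_id s) hs.ne').congr_deriv ?_
      simp
    refine ((((hu' s hs).fun_pow 2).fun_add ((hv' s hs).fun_pow 2)).fun_mul
      h1.exp).congr_deriv ?_
    simp only [Nat.cast_ofNat, Nat.add_one_sub_one, pow_one]
    field_simp
    ring
  have hanti : AntitoneOn E (Set.Ici 1) := by
    refine antitoneOn_of_deriv_nonpos (convex_Ici 1) ?_ ?_ ?_
    · exact fun s hs => (hE' s (lt_of_lt_of_le one_pos hs)).continuousAt.continuousWithinAt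
    · intro s hs
      rw [interior_Ici] at hs
      exact (hE' s (one_pos.trans hs)).differentiableAt.differentiableWithinAt
    · intro s hs
      rw [interior_Ici] at hs
      rw [(hE' s (one_pos.trans hs)).deriv]
      refine mul_nonpos_of_nonpos_of_nonneg (div_nonpos_of_nonpos_of_nonneg ?_ (sq_nonneg s))
        (Real.exp_pos _).le
      have h1 : b * (b - 1) * (u s * v s) ≤ c * |u s * v s| := by
        rw [hc, ← abs_mul]; exact le_abs_self _
      have h2 : 2 * |u s * v s| ≤ u s ^ 2 + v s ^ 2 := by
        rw [abs_mul, ← sq_abs (u s), ← sq_abs (v s)]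
        nlinarith [sq_nonneg (|u s| - |v s|)]
      nlinarith [mul_le_mul_of_nonneg_left h2 (abs_nonneg (b * (b - 1)))]
  have hE0 : 0 ≤ E 1 := by positivity
  have hEs : ∀ s, 1 ≤ s → u s ^ 2 + v s ^ 2 ≤ E 1 := by
    intro s hs
    refine le_trans ?_ (hanti (Set.mem_Ici.2 le_rfl) (Set.mem_Ici.2 hs) hs)
    exact le_mul_of_one_le_right (by positivity) (Real.one_le_exp (by positivity))
  have hus : ∀ s, 1 ≤ s → |u s| ≤ √(E 1) := fun s hs =>
    Real.abs_le_sqrt (by nlinarith [hEs s hs, sq_nonneg (v s)])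
  have hvs : ∀ s, 1 ≤ s → |v s| ≤ √(E 1) := fun s hs =>
    Real.abs_le_sqrt (by nlinarith [hEs s hs, sq_nonneg (u s)])
  have hr := Real.sqrt_nonneg (E 1)
  refine ⟨(b + 1) * √(E 1) + 1, by positivity, fun s hs => ?_⟩
  have hs0 : 0 < s := one_pos.trans_le hs
  have hsb : 0 < s ^ b := Real.rpow_pos_of_pos hs0 b
  have e1 : s ^ b * |f s| = |u s| := by simp only [hu]; rw [abs_mul, abs_of_pos hsb]
  have e2 : s ^ b * |S s| = |b * (u s / s) - v s| := by
    simp only [hv]; rw [sub_sub_cancel, abs_mul, abs_of_pos hsb]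
  rw [e1, e2]
  refine ⟨by nlinarith [hus s hs], ?_⟩
  have h3 : |u s / s| ≤ √(E 1) := by
    rw [abs_div, abs_of_pos hs0]
    exact (div_le_self (abs_nonneg _) hs).trans (hus s hs)
  have h4 := abs_sub (b * (u s / s)) (v s)
  rw [abs_mul, abs_of_nonneg hb] at h4
  nlinarith [hvs s hs, mul_le_mul_of_nonneg_left h3 hb]

theorem abs_capCos_le (n : ℕ) (s : ℝ) : |capCos n s| ≤ 2 := by
  have h := intervalIntegral.norm_integral_le_of_norm_le_const (a := -1) (b := 1) (C := 1)
    (f := fun t => √(1 - t ^ 2) ^ n * Real.cos (s * t)) fun t _ => by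
      rw [norm_mul, norm_pow, Real.norm_of_nonneg (Real.sqrt_nonneg _)]
      refine mul_le_one₀ (pow_le_one₀ (Real.sqrt_nonneg _) ?_) (norm_nonneg _)
        (Real.abs_cos_le_one _)
      exact Real.sqrt_le_one.2 (by nlinarith)
  norm_num at h
  exact h

theorem abs_capSin_le (n : ℕ) (s : ℝ) : |capSin n s| ≤ 2 := by
  have h := intervalIntegral.norm_integral_le_of_norm_le_const (a := -1) (b := 1) (C := 1)
    (f := fun t => √(1 - t ^ 2) ^ n * t * Real.sin (s * t)) fun t ht => by
      rw [Set.uIoc_of_le (by norm_num)] at ht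
      rw [norm_mul, norm_mul, norm_pow, Real.norm_of_nonneg (Real.sqrt_nonneg _)]
      refine mul_le_one₀ (mul_le_one₀ (pow_le_one₀ (Real.sqrt_nonneg _) ?_) (norm_nonneg _)
        (abs_le.2 ⟨ht.1.le, ht.2⟩)) (norm_nonneg _) (Real.abs_sin_le_one _)
      exact Real.sqrt_le_one.2 (by nlinarith)
  norm_num at h
  exact h

/-- Decay of `capCos n` and of its derivative on `[0, ∞)`. -/
theorem exists_cap_decay (n : ℕ) :
    ∃ K, 0 < K ∧ ∀ s, 0 ≤ s →
      |capCos n s| ≤ K * (1 + s) ^ (-((n : ℝ) / 2 + 1)) ∧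
      |capSin n s| ≤ K * (1 + s) ^ (-((n : ℝ) / 2 + 1)) := by
  set b : ℝ := (n : ℝ) / 2 + 1 with hb
  have hb0 : 0 ≤ b := by positivity
  obtain ⟨K, hK, h⟩ := exists_rpow_mul_le_of_bessel hb0 (hasDerivAt_capCos n)
    (hasDerivAt_capSin n) (fun s => by rw [mul_capCos_sub, hb]; ring)
  have h2b : 0 < (2 : ℝ) ^ b := Real.rpow_pos_of_pos two_pos b
  refine ⟨2 ^ b * (K + 2), by positivity, fun s hs => ?_⟩
  have main : ∀ x : ℝ, |x| ≤ 2 → (1 ≤ s → s ^ b * |x| ≤ K) →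
      |x| ≤ 2 ^ b * (K + 2) * (1 + s) ^ (-b) := by
    intro x hx2 hx
    have hp : 0 < (1 + s) ^ b := Real.rpow_pos_of_pos (by linarith) b
    rw [Real.rpow_neg (by linarith), ← div_eq_mul_inv, le_div_iff₀ hp]
    rcases le_total 1 s with h1 | h1
    · have h3 : (1 + s) ^ b ≤ 2 ^ b * s ^ b := by
        rw [← Real.mul_rpow two_pos.le hs]
        exact Real.rpow_le_rpow (by linarith) (by linarith) hb0
      calc |x| * (1 + s) ^ b ≤ |x| * (2 ^ b * s ^ b) := by gcongr
        _ = 2 ^ b * (s ^ b * |x|) := by ring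
        _ ≤ 2 ^ b * (K + 2) := by gcongr; linarith [hx h1]
    · have h3 : (1 + s) ^ b ≤ 2 ^ b := Real.rpow_le_rpow (by linarith) (by linarith) hb0
      calc |x| * (1 + s) ^ b ≤ 2 * 2 ^ b := by gcongr
        _ ≤ 2 ^ b * (K + 2) := by nlinarith
  exact ⟨main _ (abs_capCos_le n s) fun h1 => (h s h1).1,
    main _ (abs_capSin_le n s) fun h1 => (h s h1).2⟩

theorem volume_real_ball_eq {n : ℕ} {r : ℝ} (hr : 0 < r) :
    volume.real (ball (0 : EuclideanSpace ℝ (Fin n)) r) =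
      r ^ n * volume.real (ball (0 : EuclideanSpace ℝ (Fin n)) 1) := by
  rw [measureReal_def, Measure.addHaar_ball_of_pos _ _ hr, ENNReal.toReal_mul,
    finrank_euclideanSpace_fin, ENNReal.toReal_ofReal (by positivity), measureReal_def]

theorem volume_real_norm_sq_lt {n : ℕ} (hn : n ≠ 0) (ρ : ℝ) :
    volume.real {y : Fin n → ℝ | ‖WithLp.toLp 2 y‖ ^ 2 < ρ} =
      √ρ ^ n * volume.real (ball (0 : EuclideanSpace ℝ (Fin n)) 1) := by
  have h0 : {y : Fin n → ℝ | ‖WithLp.toLp 2 y‖ ^ 2 < ρ} =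
      (WithLp.toLp 2) ⁻¹' ball (0 : EuclideanSpace ℝ (Fin n)) √ρ := by
    ext y
    simp [Real.lt_sqrt (norm_nonneg _)]
  rw [h0, measureReal_def, (PiLp.volume_preserving_toLp (Fin n)).measure_preimage
    measurableSet_ball.nullMeasurableSet, ← measureReal_def]
  rcases le_or_gt ρ 0 with h | h
  · simp [Real.sqrt_eq_zero_of_nonpos h, hn]
  · exact volume_real_ball_eq (Real.sqrt_pos.2 h)

/-- Fubini along the first coordinate, for plane waves on balls. -/
theorem integral_ball_exp_eq_integral {n : ℕ} (hn : n ≠ 0) {r : ℝ} (hr : 0 < r) (Λ : ℝ) :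
    ∫ x in ball (0 : EuclideanSpace ℝ (Fin (n + 1))) r, Complex.exp (↑(-(Λ * x 0)) * Complex.I) =
      volume.real (ball (0 : EuclideanSpace ℝ (Fin n)) 1) *
        ∫ t : ℝ, (√(r ^ 2 - t ^ 2) ^ n : ℝ) * Complex.exp (↑(-(Λ * t)) * Complex.I) := by
  set e : ℝ × (Fin n → ℝ) ≃ᵐ EuclideanSpace ℝ (Fin (n + 1)) :=
    (MeasurableEquiv.piFinSuccAbove (fun _ => ℝ) 0).symm.trans (MeasurableEquiv.toLp 2 _) with he
  have hem : MeasurePreserving e :=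
    (PiLp.volume_preserving_toLp (Fin (n + 1))).comp
      ((volume_preserving_piFinSuccAbove (fun _ : Fin (n + 1) => ℝ) 0).symm _)
  have he0 : ∀ p, e p 0 = p.1 := fun p => by simp [he]
  have henorm : ∀ p, ‖e p‖ ^ 2 = p.1 ^ 2 + ‖WithLp.toLp 2 p.2‖ ^ 2 := fun p => by
    simp [he, EuclideanSpace.real_norm_sq_eq, Fin.sum_univ_succ]
  have hint : IntegrableOn (fun x : EuclideanSpace ℝ (Fin (n + 1)) =>
      Complex.exp (↑(-(Λ * x 0)) * Complex.I)) (ball 0 r) := by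
    have hc : Continuous (fun x : EuclideanSpace ℝ (Fin (n + 1)) =>
        Complex.exp (↑(-(Λ * x 0)) * Complex.I)) := by fun_prop
    exact (hc.continuousOn.integrableOn_compact (isCompact_closedBall 0 r)).mono_set
      ball_subset_closedBall
  rw [← integral_indicator measurableSet_ball]
  rw [← integrable_indicator_iff measurableSet_ball,
    ← hem.integrable_comp_emb e.measurableEmbedding] at hint
  rw [← hem.integral_comp']
  refine (integral_prod _ hint).trans ?_
  rw [← integral_const_mul]
  refine integral_congr_ae (Eventually.of_forall fun t => ?_)
  have hind : ∀ y, (ball 0 r).indicator (fun x : EuclideanSpace ℝ (Fin (n + 1)) =>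
      Complex.exp (↑(-(Λ * x 0)) * Complex.I)) (e (t, y)) =
      {y : Fin n → ℝ | ‖WithLp.toLp 2 y‖ ^ 2 < r ^ 2 - t ^ 2}.indicator
        (fun _ => Complex.exp (↑(-(Λ * t)) * Complex.I)) y := by
    intro y
    have : e (t, y) ∈ ball 0 r ↔
        y ∈ {y : Fin n → ℝ | ‖WithLp.toLp 2 y‖ ^ 2 < r ^ 2 - t ^ 2} := by
      rw [mem_ball_zero_iff, Set.mem_ofPred_eq, ← sq_lt_sq₀ (norm_nonneg _) hr.le, henorm,
        lt_sub_iff_add_lt']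
    by_cases h : e (t, y) ∈ ball 0 r
    · rw [Set.indicator_of_mem h, Set.indicator_of_mem (this.1 h), he0]
    · rw [Set.indicator_of_notMem h, Set.indicator_of_notMem (fun h' => h (this.2 h'))]
  simp only [Function.comp_apply, hind]
  rw [integral_indicator_const, volume_real_norm_sq_lt hn, Complex.real_smul]
  · push_cast; ring
  · exact measurableSet_lt (by fun_prop) measurable_const

theorem integral_sqrt_mul_exp {n : ℕ} (hn : n ≠ 0) {r : ℝ} (hr : 0 < r) (Λ : ℝ) :
    ∫ t : ℝ, (√(r ^ 2 - t ^ 2) ^ n : ℝ) * Complex.exp (↑(-(Λ * t)) * Complex.I) =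
      ((r ^ (n + 1) * capCos n (r * Λ) : ℝ) : ℂ) := by
  set g : ℝ → ℂ := fun t => (√(r ^ 2 - t ^ 2) ^ n : ℝ) * Complex.exp (↑(-(Λ * t)) * Complex.I)
    with hg
  have h1 : ∫ t, g t = r * ∫ t, g (r * t) := by
    rw [Measure.integral_comp_mul_left, abs_of_pos (inv_pos.2 hr), Complex.real_smul, ← mul_assoc]
    push_cast
    rw [mul_inv_cancel₀ (by exact_mod_cast hr.ne'), one_mul]
  have h2 : ∀ t, g (r * t) = ((r ^ n : ℝ) : ℂ) *
      ((√(1 - t ^ 2) ^ n : ℝ) * Complex.exp (↑(-(r * Λ * t)) * Complex.I)) := by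
    intro t
    have : √(r ^ 2 - (r * t) ^ 2) = r * √(1 - t ^ 2) := by
      rw [show r ^ 2 - (r * t) ^ 2 = r ^ 2 * (1 - t ^ 2) by ring, Real.sqrt_mul (by positivity),
        Real.sqrt_sq hr.le]
    simp only [hg]
    rw [this, mul_pow, show Λ * (r * t) = r * Λ * t by ring]
    push_cast
    ring
  rw [h1]
  simp only [h2]
  rw [integral_const_mul]
  have h3 : ∀ μ : ℝ, ∫ t : ℝ, ((√(1 - t ^ 2) ^ n : ℝ) : ℂ) * Complex.exp (↑(-(μ * t)) * Complex.I)
      = (capCos n μ : ℂ) := by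
    intro μ
    rw [← setIntegral_eq_integral_of_forall_compl_eq_zero (s := Set.Ioc (-1) 1),
      ← intervalIntegral.integral_of_le (by norm_num)]
    · have hsplit : ∀ t : ℝ, ((√(1 - t ^ 2) ^ n : ℝ) : ℂ) * Complex.exp (↑(-(μ * t)) * Complex.I)
          = ((√(1 - t ^ 2) ^ n * Real.cos (μ * t) : ℝ) : ℂ)
            - ((√(1 - t ^ 2) ^ n * Real.sin (μ * t) : ℝ) : ℂ) * Complex.I := by
        intro t
        rw [Complex.exp_mul_I, ← Complex.ofReal_cos, ← Complex.ofReal_sin, Real.cos_neg,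
          Real.sin_neg]
        push_cast
        ring
      have hodd : ∫ t in (-1 : ℝ)..1, √(1 - t ^ 2) ^ n * Real.sin (μ * t) = 0 := by
        have := intervalIntegral.integral_comp_neg (a := -1) (b := 1)
          (fun t => √(1 - t ^ 2) ^ n * Real.sin (μ * t))
        simp only [even_two.neg_pow, mul_neg, Real.sin_neg, neg_neg,
          intervalIntegral.integral_neg] at this
        linarith
      simp only [hsplit]
      rw [intervalIntegral.integral_sub (Continuous.intervalIntegrable (by fun_prop) _ _)
        (Continuous.intervalIntegrable (by fun_prop) _ _), intervalIntegral.integral_mul_const,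
        intervalIntegral.integral_ofReal, intervalIntegral.integral_ofReal, hodd]
      simp [capCos]
    · intro t ht
      have : 1 - t ^ 2 ≤ 0 := by
        simp only [Set.mem_Ioc, not_and_or, not_lt, not_le] at ht
        rcases ht with ht | ht <;> nlinarith
      simp [Real.sqrt_eq_zero_of_nonpos this, hn]
  rw [h3]
  push_cast
  ring

/-- The Fourier transform of a ball, in terms of `capCos`. -/
theorem integral_ball_exp_inner {n : ℕ} (hn : n ≠ 0) {r : ℝ} (hr : 0 < r)
    (ξ : EuclideanSpace ℝ (Fin (n + 1))) :
    ∫ x in ball (0 : EuclideanSpace ℝ (Fin (n + 1))) r,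
        Complex.exp (↑(-2 * Real.pi * inner ℝ x ξ) * Complex.I) =
      ((volume.real (ball (0 : EuclideanSpace ℝ (Fin n)) 1) *
        (r ^ (n + 1) * capCos n (r * (2 * Real.pi * ‖ξ‖))) : ℝ) : ℂ) := by
  set w : EuclideanSpace ℝ (Fin (n + 1)) := EuclideanSpace.single 0 ‖ξ‖ with hw
  obtain ⟨U, hU⟩ : ∃ U : EuclideanSpace ℝ (Fin (n + 1)) ≃ₗᵢ[ℝ] EuclideanSpace ℝ (Fin (n + 1)),
      U w = ξ := ⟨_, Submodule.reflection_sub (v := w) (w := ξ) (by simp [hw])⟩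
  rw [Complex.ofReal_mul, ← integral_sqrt_mul_exp hn hr, ← integral_ball_exp_eq_integral hn hr,
    ← U.measurePreserving.setIntegral_preimage_emb U.toHomeomorph.measurableEmbedding]
  have hpre : U ⁻¹' ball 0 r = ball 0 r := by
    ext x; simp
  rw [hpre]
  refine integral_congr_ae (Eventually.of_forall fun x => ?_)
  have : inner ℝ (U x) ξ = ‖ξ‖ * x 0 := by
    rw [← hU, U.inner_map_map, hw, EuclideanSpace.inner_single_right]
    simp
  simp only [this]
  congr 3
  ring

theorem exists_sub_decay (n : ℕ) :
    ∃ C, 0 < C ∧ ∀ δ, 0 < δ → δ < 1 / 2 → ∀ Λ, 0 ≤ Λ →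
      |(1 + δ) ^ (n + 1) * capCos n ((1 + δ) * Λ) - (1 - δ) ^ (n + 1) * capCos n ((1 - δ) * Λ)| ≤
        C * δ ^ (1 / 2 : ℝ) * (1 + Λ) ^ (-(((n + 1 : ℕ) : ℝ) / 2)) := by
  obtain ⟨K, hK, hdec⟩ := exists_cap_decay n
  set b : ℝ := (n : ℝ) / 2 + 1 with hb
  have hb0 : 0 ≤ b := by positivity
  set M : ℝ := 2 ^ b * K with hM
  have hMpos : 0 < M := by positivity
  have hscale : ∀ r, 1 / 2 ≤ r → ∀ Λ, 0 ≤ Λ → K * (1 + r * Λ) ^ (-b) ≤ M * (1 + Λ) ^ (-b) := by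
    intro r hr Λ hΛ
    have h1 : (1 + r * Λ) ^ (-b) ≤ ((1 + Λ) / 2) ^ (-b) :=
      Real.rpow_le_rpow_of_nonpos (by linarith) (by nlinarith) (by linarith)
    rw [Real.div_rpow (by linarith) two_pos.le, Real.rpow_neg two_pos.le, div_inv_eq_mul] at h1
    calc K * (1 + r * Λ) ^ (-b) ≤ K * ((1 + Λ) ^ (-b) * 2 ^ b) := by gcongr
      _ = M * (1 + Λ) ^ (-b) := by rw [hM]; ring
  set N : ℝ := 2 ^ (n + 1) * M with hN
  have hNpos : 0 < N := by positivity
  refine ⟨√(2 * N * (2 * ((n + 2) * N))), Real.sqrt_pos.2 (by positivity),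
    fun δ hδ hδ' Λ hΛ => ?_⟩
  set G : ℝ → ℝ := fun r => r ^ (n + 1) * capCos n (r * Λ) with hG
  set p : ℝ := (1 + Λ) ^ (-b) with hp
  have hp0 : 0 < p := Real.rpow_pos_of_pos (by linarith) _
  have hG0 : ∀ r, 1 / 2 ≤ r → r ≤ 2 → |G r| ≤ N * p := by
    intro r hr hr2
    have h := ((hdec (r * Λ) (by positivity)).1).trans (hscale r hr Λ hΛ)
    simp only [hG]
    rw [abs_mul, abs_of_nonneg (by positivity), hN, mul_assoc]
    exact mul_le_mul (pow_le_pow_left₀ (by linarith) hr2 _) h (abs_nonneg _) (by positivity)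
  have hG' : ∀ r, HasDerivAt G
      ((n + 1) * r ^ n * capCos n (r * Λ) - r ^ (n + 1) * Λ * capSin n (r * Λ)) r := by
    intro r
    have h1 := (hasDerivAt_capCos n (r * Λ)).comp r ((hasDerivAt_id r).mul_const Λ)
    refine ((hasDerivAt_pow (n + 1) r).fun_mul h1).congr_deriv ?_
    simp only [Function.comp, id, Nat.add_sub_cancel]
    push_cast
    ring
  have hG1 : ∀ r, 1 / 2 ≤ r → r ≤ 2 →
      ‖(n + 1) * r ^ n * capCos n (r * Λ) - r ^ (n + 1) * Λ * capSin n (r * Λ)‖ ≤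
        (n + 2) * N * (p * (1 + Λ)) := by
    intro r hr hr2
    have h := hdec (r * Λ) (by positivity)
    have hc := h.1.trans (hscale r hr Λ hΛ)
    have hs := h.2.trans (hscale r hr Λ hΛ)
    have hr0 : 0 ≤ r := by linarith
    have e1 : r ^ n ≤ 2 ^ (n + 1) :=
      (pow_le_pow_left₀ hr0 hr2 n).trans (pow_le_pow_right₀ (by norm_num) (Nat.le_succ n))
    have e2 : r ^ (n + 1) ≤ 2 ^ (n + 1) := pow_le_pow_left₀ hr0 hr2 _
    calc ‖(n + 1) * r ^ n * capCos n (r * Λ) - r ^ (n + 1) * Λ * capSin n (r * Λ)‖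
        ≤ |(n + 1) * r ^ n * capCos n (r * Λ)| + |r ^ (n + 1) * Λ * capSin n (r * Λ)| :=
          abs_sub _ _
      _ = (n + 1) * r ^ n * |capCos n (r * Λ)| + r ^ (n + 1) * Λ * |capSin n (r * Λ)| := by
          rw [abs_mul, abs_mul _ (capSin n (r * Λ)),
            abs_of_nonneg (show 0 ≤ ((n : ℝ) + 1) * r ^ n by positivity),
            abs_of_nonneg (show 0 ≤ r ^ (n + 1) * Λ by positivity)]
      _ ≤ (n + 1) * 2 ^ (n + 1) * (M * p) + 2 ^ (n + 1) * Λ * (M * p) := by gcongr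
      _ = N * p * (n + 1 + Λ) := by rw [hN]; ring
      _ ≤ N * p * ((n + 2) * (1 + Λ)) := by
          gcongr
          nlinarith [mul_nonneg (Nat.cast_nonneg (α := ℝ) n) hΛ]
      _ = (n + 2) * N * (p * (1 + Λ)) := by ring
  have hA : |G (1 + δ) - G (1 - δ)| ≤ 2 * N * p := by
    have h1 := hG0 (1 + δ) (by linarith) (by linarith)
    have h2 := hG0 (1 - δ) (by linarith) (by linarith)
    linarith [abs_sub (G (1 + δ)) (G (1 - δ))]
  have hB : |G (1 + δ) - G (1 - δ)| ≤ 2 * ((n + 2) * N) * (δ * (p * (1 + Λ))) := by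
    have h := norm_image_sub_le_of_norm_deriv_le_segment' (a := 1 - δ) (b := 1 + δ)
      (fun r _ => (hG' r).hasDerivWithinAt)
      (fun r hr => hG1 r (by linarith [hr.1]) (by linarith [hr.2])) (1 + δ)
      ⟨by linarith, le_rfl⟩
    rw [Real.norm_eq_abs] at h
    linarith
  have hpp : p * (p * (1 + Λ)) = ((1 + Λ) ^ (-(((n + 1 : ℕ) : ℝ) / 2))) ^ 2 := by
    have h1 : (0 : ℝ) < 1 + Λ := by linarith
    rw [← Real.rpow_natCast, ← Real.rpow_mul h1.le, ← Real.rpow_add_one h1.ne',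
      ← Real.rpow_add h1, hb]
    congr 1
    push_cast
    ring
  change |G (1 + δ) - G (1 - δ)| ≤ _
  have hsq : |G (1 + δ) - G (1 - δ)| ^ 2 ≤
      2 * N * (2 * ((n + 2) * N)) * δ * ((1 + Λ) ^ (-(((n + 1 : ℕ) : ℝ) / 2))) ^ 2 := by
    rw [← hpp, sq]
    calc _ ≤ 2 * N * p * (2 * ((n + 2) * N) * (δ * (p * (1 + Λ)))) :=
          mul_le_mul hA hB (abs_nonneg _) (by positivity)
      _ = _ := by ring
  rw [← Real.sqrt_eq_rpow]
  refine (sq_le_sq₀ (abs_nonneg _) (by positivity)).1 ?_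
  rwa [mul_pow, mul_pow, Real.sq_sqrt (by positivity), Real.sq_sqrt hδ.le]

theorem annulus_eq_diff (d : ℕ) (δ : ℝ) :
    annulus d δ = ball 0 (1 + δ) \ closedBall 0 (1 - δ) := by
  ext x
  simp [annulus, and_comm]

theorem ball_ae_eq_closedBall_zero (n : ℕ) (r : ℝ) (hr : 0 < r) :
    (closedBall (0 : EuclideanSpace ℝ (Fin n)) r : Set _) =ᵐ[volume] ball 0 r := by
  rw [← ball_union_sphere]
  exact union_ae_eq_left_of_ae_eq_empty
    (ae_eq_empty.2 (Measure.addHaar_sphere_of_ne_zero _ _ hr.ne'))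

theorem le_volume_annulus {d : ℕ} (hd : d ≠ 0) {δ : ℝ} (hδ : 0 < δ) (hδ' : δ < 1 / 2) :
    2 * δ * volume.real (ball (0 : EuclideanSpace ℝ (Fin d)) 1) ≤ volume.real (annulus d δ) := by
  rw [annulus_eq_diff, measureReal_sdiff (closedBall_subset_ball (by linarith))
    measurableSet_closedBall, measureReal_congr (ball_ae_eq_closedBall_zero d _ (by linarith)),
    volume_real_ball_eq (r := 1 + δ) (by linarith),
    volume_real_ball_eq (r := 1 - δ) (by linarith), ← sub_mul]
  gcongr
  have h1 : 1 + δ ≤ (1 + δ) ^ d := le_self_pow₀ (by linarith) hd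
  have h2 : (1 - δ) ^ d ≤ 1 - δ := pow_le_of_le_one (by linarith) (by linarith) hd
  linarith

theorem fourier_indicator_annulus {n : ℕ} (hn : n ≠ 0) {δ : ℝ} (hδ : 0 < δ) (hδ' : δ < 1 / 2)
    (ξ : EuclideanSpace ℝ (Fin (n + 1))) :
    𝓕 ((annulus (n + 1) δ).indicator fun _ => (1 : ℂ)) ξ =
      ((volume.real (ball (0 : EuclideanSpace ℝ (Fin n)) 1) *
        ((1 + δ) ^ (n + 1) * capCos n ((1 + δ) * (2 * Real.pi * ‖ξ‖)) -
          (1 - δ) ^ (n + 1) * capCos n ((1 - δ) * (2 * Real.pi * ‖ξ‖))) : ℝ) : ℂ) := by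
  have hmeas : MeasurableSet (annulus (n + 1) δ) := by
    rw [annulus_eq_diff]; exact measurableSet_ball.diff measurableSet_closedBall
  have hc : Continuous (fun x : EuclideanSpace ℝ (Fin (n + 1)) =>
      Complex.exp (↑(-2 * Real.pi * inner ℝ x ξ) * Complex.I)) := by fun_prop
  have hint : IntegrableOn (fun x : EuclideanSpace ℝ (Fin (n + 1)) =>
      Complex.exp (↑(-2 * Real.pi * inner ℝ x ξ) * Complex.I)) (ball 0 (1 + δ)) :=
    (hc.continuousOn.integrableOn_compact (isCompact_closedBall 0 (1 + δ))).mono_set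
      ball_subset_closedBall
  have h1 : 𝓕 ((annulus (n + 1) δ).indicator fun _ => (1 : ℂ)) ξ =
      ∫ x in annulus (n + 1) δ, Complex.exp (↑(-2 * Real.pi * inner ℝ x ξ) * Complex.I) := by
    rw [Real.fourier_eq', ← integral_indicator hmeas]
    refine integral_congr_ae (Eventually.of_forall fun x => ?_)
    by_cases h : x ∈ annulus (n + 1) δ <;> simp [h]
  rw [h1, annulus_eq_diff, setIntegral_sdiff measurableSet_closedBall hint
    (closedBall_subset_ball (by linarith)),
    setIntegral_congr_set (ball_ae_eq_closedBall_zero _ _ (by linarith)),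
    integral_ball_exp_inner hn (by linarith), integral_ball_exp_inner hn (by linarith)]
  push_cast
  ring

/-- For `d ≥ 2` there is a constant `C_d` such that for all `δ ∈ (0,1/2)` and `ξ ∈ ℝ^d`,
`|χ̂_{C^δ(0,1)}(ξ)| / |C^δ(0,1)| ≤ C_d δ^{-1/2} (1+|ξ|)^{-d/2}`. -/
theorem fourier_indicator_annulus_normalised_decay (d : ℕ) (hd : 2 ≤ d) :
    ∃ C : ℝ, 0 < C ∧ ∀ δ : ℝ, 0 < δ → δ < 1/2 → ∀ ξ : EuclideanSpace ℝ (Fin d),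
      ‖𝓕 ((annulus d δ).indicator fun _ => (1:ℂ)) ξ‖ / (volume (annulus d δ)).toReal ≤
        C * δ ^ (-(1/2) : ℝ) * (1 + ‖ξ‖) ^ (-((d:ℝ) / 2)) := by
  obtain ⟨n, rfl⟩ : ∃ n, d = n + 1 := ⟨d - 1, by omega⟩
  have hn : n ≠ 0 := by omega
  obtain ⟨C, hC, hdec⟩ := exists_sub_decay n
  set v := volume.real (ball (0 : EuclideanSpace ℝ (Fin n)) 1) with hv
  set V := volume.real (ball (0 : EuclideanSpace ℝ (Fin (n + 1))) 1) with hV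
  have hvpos : 0 < v := ENNReal.toReal_pos (measure_ball_pos _ _ one_pos).ne' measure_ball_lt_top.ne
  have hVpos : 0 < V := ENNReal.toReal_pos (measure_ball_pos _ _ one_pos).ne' measure_ball_lt_top.ne
  refine ⟨v * C / (2 * V), by positivity, fun δ hδ hδ' ξ => ?_⟩
  have hvol := le_volume_annulus (Nat.succ_ne_zero n) hδ hδ'
  rw [← hV] at hvol
  have hA : 0 < volume.real (annulus (n + 1) δ) := lt_of_lt_of_le (by positivity) hvol
  rw [fourier_indicator_annulus hn hδ hδ' ξ, Complex.norm_real, Real.norm_eq_abs, abs_mul,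
    abs_of_pos hvpos, ← measureReal_def]
  set P := (1 + ‖ξ‖) ^ (-(((n + 1 : ℕ) : ℝ) / 2)) with hP
  have hP0 : 0 ≤ P := by positivity
  have hmono : (1 + 2 * Real.pi * ‖ξ‖) ^ (-(((n + 1 : ℕ) : ℝ) / 2)) ≤ P := by
    refine Real.rpow_le_rpow_of_nonpos (by positivity) ?_
      (neg_nonpos.2 (by positivity))
    nlinarith [Real.pi_gt_three, norm_nonneg ξ]
  have hnum := hdec δ hδ hδ' (2 * Real.pi * ‖ξ‖) (by positivity)
  have hδe : δ ^ (1 / 2 : ℝ) = δ * δ ^ (-(1 / 2) : ℝ) := by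
    rw [← Real.rpow_one_add' hδ.le (by norm_num)]; norm_num
  have hδp : 0 < δ ^ (-(1 / 2) : ℝ) := Real.rpow_pos_of_pos hδ _
  rw [div_le_iff₀ hA]
  calc _ ≤ v * (C * δ ^ (1 / 2 : ℝ) * P) := by
        refine mul_le_mul_of_nonneg_left (hnum.trans ?_) hvpos.le
        gcongr
    _ = v * C / (2 * V) * δ ^ (-(1 / 2) : ℝ) * P * (2 * δ * V) := by
        rw [hδe]; field_simp
    _ ≤ _ := by gcongr
end
end

section
/- Let d ≥ 2. There exists a constant C_d such that for every δ ∈ (0,1/2), all integers ℓ ≤ k, every cube Q ⊂ ℝ^d of side length 20·2^ℓ, and the set A := {y ∈ ℝ^d : dist(y, 2^k S^{d−1}) ≤ 2^k δ} (the 2^kδ-neighbourhood of the sphere of radius 2^k centred at the origin), the Minkowski sum satisfies the volume bound |Q + A| ≤ C_d · 2^{kd} · (δ + 2^{ℓ−k}). -/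
open MeasureTheory Metric Filter
open scoped ENNReal FourierTransform Pointwise Topology

noncomputable section

/-- The Euclidean norm is at most the dimension times any bound on the coordinates. -/
lemma EuclideanSpace.norm_le_card_mul_of_abs_le {d : ℕ} {x : EuclideanSpace ℝ (Fin d)} {r : ℝ}
    (hr : 0 ≤ r) (h : ∀ i, |x i| ≤ r) : ‖x‖ ≤ d * r := by
  rw [EuclideanSpace.norm_eq]
  apply Real.sqrt_le_iff.2 ⟨by positivity, ?_⟩
  calc ∑ i, ‖x i‖ ^ 2 ≤ ∑ _i : Fin d, r ^ 2 := by
        gcongr with i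
        exact h i
    _ = d * r ^ 2 := by simp
    _ ≤ (d : ℝ) ^ 2 * r ^ 2 := by
        gcongr
        exact_mod_cast Nat.le_self_pow two_ne_zero d
    _ = (d * r) ^ 2 := by ring

/-- The volume of a spherical shell is at most the dimension times its width times the
`(d - 1)`-st power of its outer radius, up to the volume of the unit ball. -/
lemma EuclideanSpace.volume_closedBall_diff_ball_le {d : ℕ} (c : EuclideanSpace ℝ (Fin d))
    {a b : ℝ} (hb : 0 ≤ b) (hab : b ≤ a) (hd : d ≠ 0) :
    volume (closedBall c a \ ball c b) ≤
      ENNReal.ofReal ((a - b) * d * a ^ (d - 1) *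
        (volume (ball (0 : EuclideanSpace ℝ (Fin d)) 1)).toReal) := by
  have : Nonempty (Fin d) := ⟨⟨0, Nat.pos_of_ne_zero hd⟩⟩
  have ha : 0 ≤ a := hb.trans hab
  rw [measure_sdiff (ball_subset_closedBall.trans (closedBall_subset_closedBall hab))
    measurableSet_ball.nullMeasurableSet measure_ball_lt_top.ne,
    Measure.addHaar_closedBall _ _ ha, Measure.addHaar_ball _ _ hb, finrank_euclideanSpace_fin,
    ← ENNReal.sub_mul (fun _ _ ↦ measure_ball_lt_top.ne),
    ← ENNReal.ofReal_sub _ (by positivity), ENNReal.ofReal_mul' ENNReal.toReal_nonneg,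
    ENNReal.ofReal_toReal measure_ball_lt_top.ne]
  gcongr
  have h := abs_pow_sub_pow_le a b d
  rw [abs_of_nonneg (sub_nonneg.2 hab), abs_of_nonneg ha, abs_of_nonneg hb,
    max_eq_left hab] at h
  exact (le_abs_self _).trans h

/-- For `d ≥ 2` there is `C_d` such that for every `δ ∈ (0,1/2)`, integers `ℓ ≤ k`, every
axis-parallel cube `Q` of side length `20·2^ℓ` and the `2^k δ`-neighbourhood `A` of the
sphere of radius `2^k` centred at the origin, `|Q + A| ≤ C_d 2^{kd} (δ + 2^{ℓ-k})`. -/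
theorem volume_cube_add_sphere_neighbourhood (d : ℕ) (hd : 2 ≤ d) :
    ∃ C : ℝ, 0 < C ∧ ∀ δ : ℝ, 0 < δ → δ < 1/2 → ∀ l k : ℤ, l ≤ k →
      ∀ c : EuclideanSpace ℝ (Fin d),
        volume ({x : EuclideanSpace ℝ (Fin d) | ∀ i, |x i - c i| ≤ 10 * (2:ℝ) ^ l} +
            {y : EuclideanSpace ℝ (Fin d) | ∃ z : EuclideanSpace ℝ (Fin d),
              ‖z‖ = (2:ℝ) ^ k ∧ ‖y - z‖ ≤ (2:ℝ) ^ k * δ}) ≤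
          ENNReal.ofReal (C * (2:ℝ) ^ (k * (d:ℤ)) * (δ + (2:ℝ) ^ (l - k))) := by
  have hd0 : d ≠ 0 := by omega
  have hd1 : (1 : ℝ) ≤ d := by exact_mod_cast Nat.one_le_iff_ne_zero.2 hd0
  set V := (volume (ball (0 : EuclideanSpace ℝ (Fin d)) 1)).toReal with hV
  have hVpos : 0 < V := ENNReal.toReal_pos (measure_ball_pos _ _ one_pos).ne'
    measure_ball_lt_top.ne
  refine ⟨20 * d * d * (12 * d) ^ (d - 1) * V, by positivity, ?_⟩
  intro δ hδ hδ2 l k hlk c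
  set R : ℝ := 2 ^ k with hR
  set ε : ℝ := 2 ^ (l - k) with hε
  have hRpos : 0 < R := by positivity
  have hεpos : 0 < ε := by positivity
  have hε1 : ε ≤ 1 := zpow_le_one_of_nonpos₀ one_le_two (by omega)
  have hl : (2 : ℝ) ^ l = R * ε := by
    rw [hR, hε, ← zpow_add₀ two_ne_zero]
    congr 1
    ring
  have hRd : (2 : ℝ) ^ (k * (d : ℤ)) = R ^ d := by rw [zpow_mul, zpow_natCast]
  rw [hl, hRd]
  set s : ℝ := δ + 10 * d * ε with hs
  have hspos : 0 < s := by positivity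
  have hs1 : s ≤ 10 * d * (δ + ε) := by nlinarith
  have hs2 : 1 + s ≤ 12 * d := by nlinarith
  have hsub : {x : EuclideanSpace ℝ (Fin d) | ∀ i, |x i - c i| ≤ 10 * (R * ε)} +
      {y : EuclideanSpace ℝ (Fin d) | ∃ z : EuclideanSpace ℝ (Fin d),
        ‖z‖ = R ∧ ‖y - z‖ ≤ R * δ} ⊆
      closedBall c (R * (1 + s)) \ ball c (R * max 0 (1 - s)) := by
    rintro _ ⟨x, hx, y, ⟨z, hz, hyz⟩, rfl⟩
    have hxc : ‖x - c‖ ≤ d * (10 * (R * ε)) :=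
      EuclideanSpace.norm_le_card_mul_of_abs_le (by positivity) hx
    have hdist : ‖(x + y - c) - z‖ ≤ R * s := by
      calc ‖(x + y - c) - z‖ = ‖(x - c) + (y - z)‖ := by congr 1; abel
        _ ≤ ‖x - c‖ + ‖y - z‖ := norm_add_le _ _
        _ ≤ d * (10 * (R * ε)) + R * δ := by gcongr
        _ = R * s := by rw [hs]; ring
    have habs := abs_le.1 ((abs_norm_sub_norm_le (x + y - c) z).trans hdist)
    rw [hz] at habs
    simp only [Set.mem_sdiff, mem_closedBall, mem_ball, dist_eq_norm, not_lt]
    refine ⟨by linarith, ?_⟩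
    rw [mul_max_of_nonneg _ _ hRpos.le, mul_zero]
    exact max_le (norm_nonneg _) (by linarith)
  have hmax : max 0 (1 - s) ≤ 1 + s := max_le (by linarith) (by linarith)
  have hwidth : 1 + s - max 0 (1 - s) ≤ 2 * s := by linarith [le_max_right 0 (1 - s)]
  refine (measure_mono hsub).trans
    ((EuclideanSpace.volume_closedBall_diff_ball_le c (by positivity) (by gcongr) hd0).trans ?_)
  apply ENNReal.ofReal_le_ofReal
  rw [← hV]
  calc (R * (1 + s) - R * max 0 (1 - s)) * d * (R * (1 + s)) ^ (d - 1) * V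
      = (1 + s - max 0 (1 - s)) * d * (1 + s) ^ (d - 1) * (R ^ (d - 1) * R) * V := by
        rw [mul_pow]
        ring
    _ ≤ (2 * (10 * d * (δ + ε))) * d * (12 * d) ^ (d - 1) * (R ^ (d - 1) * R) * V := by
        gcongr
        linarith
    _ = 20 * d * d * (12 * d) ^ (d - 1) * V * R ^ d * (δ + ε) := by
        rw [pow_sub_one_mul hd0]
        ring
end
end
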